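/- Let n ∈ ℕ, p ∈ (0,1], and let X = (ℝ², ‖·‖_X) be any two-dimensional normed space. Then for every unit vector θ in ℝ^n: |B_p^n(X) ∩ H_diag| ≤ |B_p^n(X) ∩ H_θ| ≤ |B_p^{n−1}(X)|, where H_diag = {(x_1,…,x_n) ∈ (ℝ²)^n : ∑_{i=1}^n x_i = 0}. -/

import Mathlib

open MeasureTheory Real Filter
open scoped ENNReal

noncomputable section

/-- `N` is a quasi-norm on `ℝ^m`. -/
def IsQuasiNorm (m : ℕ) (N : (Fin m → ℝ) → ℝ) : Prop :=
  (∀ x, 0 ≤ N x) ∧ (∀ x, N x = 0 ↔ x = 0) ∧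
    (∀ (a : ℝ) (x : Fin m → ℝ), N (a • x) = |a| * N x) ∧
    ∃ C : ℝ, 1 ≤ C ∧ ∀ x y, N (x + y) ≤ C * (N x + N y)

/-- `X = (ℝ^m, N)` admits an isometric embedding into some `L_p(μ)` space:
there are a measure space `(Ω, μ)` and a linear map `T : ℝ^m → L_p(μ)` with
`‖T x‖_{L_p(μ)} = N x` for every `x`. -/
def EmbedsIntoLp (m : ℕ) (p : ℝ) (N : (Fin m → ℝ) → ℝ) : Prop :=
  ∃ (Ω : Type) (_ : MeasurableSpace Ω) (μ : Measure Ω) (T : (Fin m → ℝ) →ₗ[ℝ] (Ω → ℝ)),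
    (∀ x, Integrable (fun ω => |T x ω| ^ p) μ) ∧
    ∀ x, (∫ ω, |T x ω| ^ p ∂μ) ^ (1 / p) = N x

/-- `α` is majorized by `β`: for every `k`, the sum of the `k` largest entries of `α` is at
most that of `β` (expressed via finite subsets: the sum of the `k` largest entries is the
maximum of `∑ i ∈ A, · i` over sets `A` of cardinality `k`), and the total sums agree. -/
def IsMajorizedBy {n : ℕ} (α β : Fin n → ℝ) : Prop :=
  (∀ A : Finset (Fin n), ∃ B : Finset (Fin n), B.card = A.card ∧ ∑ i ∈ A, α i ≤ ∑ i ∈ B, β i) ∧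
    ∑ i, α i = ∑ i, β i

/-- The unit ball `B_p^n(X)` of `ℓ_p^n(X)` for `X = (ℝ^m, N)` and `0 < p < ∞`. -/
def lpBall (m n : ℕ) (p : ℝ) (N : (Fin m → ℝ) → ℝ) : Set (Fin n × Fin m → ℝ) :=
  {x | ∑ i : Fin n, N (fun j => x (i, j)) ^ p ≤ 1}

/-- The block hyperplane `H_θ = {(x_1,…,x_n) ∈ (ℝ^m)^n : ∑ θ_i x_i = 0}`. -/
def blockHyp (m n : ℕ) (θ : Fin n → ℝ) : Set (Fin n × Fin m → ℝ) :=
  {x | ∀ j : Fin m, ∑ i : Fin n, θ i * x (i, j) = 0}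

/-- `ι` is a linear isometric parametrization (w.r.t. the Euclidean structures) of the
subspace `H` of `ℝ^{mn} = (ℝ^m)^n` by `ℝ^d`; for `A ⊆ H`, `volume (⇑ι ⁻¹' A)` is then the
`d`-dimensional Lebesgue measure of `A` inside `H`. -/
def IsEuclParam (m n d : ℕ) (ι : (Fin d → ℝ) →ₗ[ℝ] (Fin n × Fin m → ℝ))
    (H : Set (Fin n × Fin m → ℝ)) : Prop :=
  (∀ y, ∑ c, ι y c ^ 2 = ∑ i, y i ^ 2) ∧ Set.range ⇑ι = H

/-- `N` is a norm on `ℝ^m`. -/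
def IsNormOn (m : ℕ) (N : (Fin m → ℝ) → ℝ) : Prop :=
  (∀ x, N x = 0 ↔ x = 0) ∧ (∀ (a : ℝ) (x : Fin m → ℝ), N (a • x) = |a| * N x) ∧
    ∀ x y, N (x + y) ≤ N x + N y

open scoped Topology

/-- The smallest class of functions on `ℝ²` containing all Gaussians `exp (-q)` with `q` a
nonnegative quadratic form, closed under nonnegative linear combinations and under uniformly
bounded pointwise limits. -/
inductive IsGaussMix : ((Fin 2 → ℝ) → ℝ) → Prop
  | gauss (a b c : ℝ) (h : ∀ x y : ℝ, 0 ≤ a * x ^ 2 + b * (x * y) + c * y ^ 2) :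
      IsGaussMix fun v => exp (-(a * v 0 ^ 2 + b * (v 0 * v 1) + c * v 1 ^ 2))
  | add (f g : (Fin 2 → ℝ) → ℝ) (hf : IsGaussMix f) (hg : IsGaussMix g) :
      IsGaussMix fun v => f v + g v
  | smul (r : ℝ) (hr : 0 ≤ r) (f : (Fin 2 → ℝ) → ℝ) (hf : IsGaussMix f) :
      IsGaussMix fun v => r * f v
  | lim (f : ℕ → (Fin 2 → ℝ) → ℝ) (g : (Fin 2 → ℝ) → ℝ) (C : ℝ) (hf : ∀ k, IsGaussMix (f k))
      (hC : ∀ k v, f k v ≤ C) (h : ∀ v, Tendsto (fun k => f k v) atTop (𝓝 (g v))) :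
      IsGaussMix g

namespace IsGaussMix

variable {f g : (Fin 2 → ℝ) → ℝ}

lemma nonneg (hf : IsGaussMix f) : ∀ v, 0 ≤ f v := by
  induction hf with
  | gauss a b c h => exact fun v => (exp_pos _).le
  | add f g _ _ ihf ihg => exact fun v => add_nonneg (ihf v) (ihg v)
  | smul r hr f _ ih => exact fun v => mul_nonneg hr (ih v)
  | lim f g C _ _ h ih => exact fun v => ge_of_tendsto' (h v) fun k => ih k v

lemma exists_bound (hf : IsGaussMix f) : ∃ C, ∀ v, f v ≤ C := by
  induction hf with
  | gauss a b c h =>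
    exact ⟨1, fun v => exp_le_one_iff.2 (neg_nonpos.2 (h (v 0) (v 1)))⟩
  | add f g _ _ ihf ihg =>
    obtain ⟨C, hC⟩ := ihf
    obtain ⟨D, hD⟩ := ihg
    exact ⟨C + D, fun v => add_le_add (hC v) (hD v)⟩
  | smul r hr f _ ih =>
    obtain ⟨C, hC⟩ := ih
    exact ⟨r * C, fun v => mul_le_mul_of_nonneg_left (hC v) hr⟩
  | lim f g C _ hC h _ => exact ⟨C, fun v => le_of_tendsto' (h v) fun k => hC k v⟩

lemma measurable (hf : IsGaussMix f) : Measurable f := by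
  induction hf with
  | gauss a b c h => fun_prop
  | add f g _ _ ihf ihg => exact ihf.add ihg
  | smul r hr f _ ih => exact ih.const_mul r
  | lim f g C _ hC h ih => exact measurable_of_tendsto_metrizable ih (tendsto_pi_nhds.2 h)

lemma const {r : ℝ} (hr : 0 ≤ r) : IsGaussMix fun _ => r := by
  convert smul r hr _ (gauss 0 0 0 (by simp)) using 2
  simp

lemma mul_gauss (hf : IsGaussMix f) {a b c : ℝ}
    (h : ∀ x y : ℝ, 0 ≤ a * x ^ 2 + b * (x * y) + c * y ^ 2) :
    IsGaussMix fun v => f v * exp (-(a * v 0 ^ 2 + b * (v 0 * v 1) + c * v 1 ^ 2)) := by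
  induction hf with
  | gauss a' b' c' h' =>
    convert gauss (a' + a) (b' + b) (c' + c) ?_ using 2 with v
    · rw [← exp_add]
      congr 1
      ring
    · intro x y
      linarith [h x y, h' x y]
  | add f g _ _ ihf ihg =>
    convert add _ _ ihf ihg using 2
    ring
  | smul r hr f _ ih =>
    convert smul r hr _ ih using 2
    ring
  | lim f g C hf hC hl ih =>
    refine lim _ _ C ih (fun k v => ?_) fun v => (hl v).mul_const _
    exact (mul_le_of_le_one_right ((hf k).nonneg v)
      (exp_le_one_iff.2 (neg_nonpos.2 (h (v 0) (v 1))))).trans (hC k v)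

lemma mul (hf : IsGaussMix f) (hg : IsGaussMix g) : IsGaussMix fun v => f v * g v := by
  induction hg with
  | gauss a b c h => exact hf.mul_gauss h
  | add g₁ g₂ _ _ ih₁ ih₂ =>
    convert add _ _ ih₁ ih₂ using 2
    ring
  | smul r hr g _ ih =>
    convert smul r hr _ ih using 2
    ring
  | lim g g' C hg hC hl ih =>
    obtain ⟨D, hD⟩ := hf.exists_bound
    refine lim _ _ (D * C) ih (fun k v => ?_) fun v => (hl v).const_mul _
    exact mul_le_mul (hD v) (hC k v) ((hg k).nonneg v) ((hf.nonneg v).trans (hD v))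

lemma pow (hf : IsGaussMix f) (k : ℕ) : IsGaussMix fun v => f v ^ k := by
  induction k with
  | zero => simpa using const zero_le_one
  | succ k ih => simpa [pow_succ] using ih.mul hf

lemma sum {ι : Type*} (s : Finset ι) (F : ι → (Fin 2 → ℝ) → ℝ) (hF : ∀ i ∈ s, IsGaussMix (F i)) :
    IsGaussMix fun v => ∑ i ∈ s, F i v := by
  classical
  induction s using Finset.induction_on with
  | empty => simpa using const le_rfl
  | insert i s hi ih =>
    simp only [Finset.sum_insert hi]
    exact add _ _ (hF i (by simp)) (ih fun j hj => hF j (by simp [hj]))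

end IsGaussMix

lemma neg_one_pow_mul_choose_succ_nonneg {α : ℝ} (h0 : 0 ≤ α) (h1 : α ≤ 1) (k : ℕ) :
    0 ≤ (-1) ^ k * Ring.choose α (k + 1) := by
  have hrec : ∀ k : ℕ, Ring.choose α (k + 1) = Ring.choose α k * (α - k) / (k + 1) := by
    intro k
    have hk : (k.factorial : ℝ) ≠ 0 := by positivity
    have hk' : (k : ℝ) + 1 ≠ 0 := by positivity
    rw [Ring.choose_eq_smul, Ring.choose_eq_smul, descPochhammer_succ_right,
      Polynomial.smeval_mul, Polynomial.smeval_sub, Polynomial.smeval_X,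
      Polynomial.smeval_natCast, Nat.factorial_succ]
    simp only [smul_eq_mul, Nat.cast_mul, Nat.cast_add, Nat.cast_one, pow_one, pow_zero,
      nsmul_eq_mul, mul_one]
    field_simp
  induction k with
  | zero => simpa using h0
  | succ k ih =>
    rw [hrec (k + 1)]
    have : (-1) ^ (k + 1) * (Ring.choose α (k + 1) * (α - (k + 1 : ℕ)) / ((k + 1 : ℕ) + 1)) =
        (-1) ^ k * Ring.choose α (k + 1) * ((k + 1 - α) / (k + 2)) := by
      push_cast
      field_simp
      ring
    rw [this]
    exact mul_nonneg ih (div_nonneg (by have : (0 : ℝ) ≤ k := by positivity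
                                        linarith) (by positivity))

lemma hasSum_one_sub_one_sub_rpow {α z : ℝ} (hz0 : 0 ≤ z) (hz1 : z < 1) :
    HasSum (fun k : ℕ => (-1) ^ k * Ring.choose α (k + 1) * z ^ (k + 1)) (1 - (1 - z) ^ α) := by
  have h := (Real.one_add_rpow_hasFPowerSeriesOnBall_zero (a := α)).hasSum (y := -z)
    (by simp [abs_of_nonneg hz0, hz1, enorm_eq_nnnorm, ← NNReal.coe_lt_coe])
  simp only [binomialSeries_apply, List.ofFn_const, List.prod_replicate, smul_eq_mul,
    zero_add] at h
  have h2 := ((hasSum_nat_add_iff' 1).2 h).neg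
  rw [Finset.sum_range_one, Ring.choose_zero_right, pow_zero, ← sub_eq_add_neg] at h2
  have hlim : -((1 - z) ^ α - 1 * 1) = 1 - (1 - z) ^ α := by ring
  rw [hlim] at h2
  refine h2.congr_fun fun k => ?_
  rw [neg_pow z]
  ring

namespace IsGaussMix

lemma one_sub_one_sub_rpow {f : (Fin 2 → ℝ) → ℝ} (hf : IsGaussMix f) (hf1 : ∀ v, f v < 1)
    {α : ℝ} (h0 : 0 ≤ α) (h1 : α ≤ 1) : IsGaussMix fun v => 1 - (1 - f v) ^ α := by
  have hs := fun v => hasSum_one_sub_one_sub_rpow (α := α) (hf.nonneg v) (hf1 v)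
  refine lim (fun m v => ∑ k ∈ Finset.range m,
    (-1) ^ k * Ring.choose α (k + 1) * f v ^ (k + 1)) _ 1 (fun m => ?_) (fun m v => ?_)
    fun v => (hs v).tendsto_sum_nat
  · exact sum _ _ fun k _ => smul _ (neg_one_pow_mul_choose_succ_nonneg h0 h1 k) _ (hf.pow _)
  · refine (sum_le_hasSum _ (fun k _ => ?_) (hs v)).trans ?_
    · exact mul_nonneg (neg_one_pow_mul_choose_succ_nonneg h0 h1 k) (pow_nonneg (hf.nonneg v) _)
    · linarith [rpow_nonneg (sub_nonneg.2 (hf1 v).le) α]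

end IsGaussMix

/-- Nonnegative functions `h` such that `exp (-t * h)` is a Gaussian mixture for all `t ≥ 0`. -/
def IsGaussExponent (h : (Fin 2 → ℝ) → ℝ) : Prop :=
  (∀ v, 0 ≤ h v) ∧ ∀ t : ℝ, 0 ≤ t → IsGaussMix fun v => exp (-(t * h v))

namespace IsGaussExponent

variable {h h' : (Fin 2 → ℝ) → ℝ}

lemma add (hh : IsGaussExponent h) (hh' : IsGaussExponent h') :
    IsGaussExponent fun v => h v + h' v := by
  refine ⟨fun v => add_nonneg (hh.1 v) (hh'.1 v), fun t ht => ?_⟩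
  convert (hh.2 t ht).mul (hh'.2 t ht) using 2
  rw [← exp_add]
  congr 1
  ring

lemma const {r : ℝ} (hr : 0 ≤ r) : IsGaussExponent fun _ => r :=
  ⟨fun _ => hr, fun _ _ => IsGaussMix.const (exp_pos _).le⟩

lemma smul {r : ℝ} (hr : 0 ≤ r) (hh : IsGaussExponent h) : IsGaussExponent fun v => r * h v := by
  refine ⟨fun v => mul_nonneg hr (hh.1 v), fun t ht => ?_⟩
  convert hh.2 (t * r) (mul_nonneg ht hr) using 2
  ring_nf

lemma sum {ι : Type*} (s : Finset ι) (F : ι → (Fin 2 → ℝ) → ℝ)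
    (hF : ∀ i ∈ s, IsGaussExponent (F i)) : IsGaussExponent fun v => ∑ i ∈ s, F i v := by
  classical
  induction s using Finset.induction_on with
  | empty => simpa using const le_rfl
  | insert i s hi ih =>
    simp only [Finset.sum_insert hi]
    exact (hF i (by simp)).add (ih fun j hj => hF j (by simp [hj]))

lemma lim (F : ℕ → (Fin 2 → ℝ) → ℝ) (hF : ∀ k, IsGaussExponent (F k))
    (hl : ∀ v, Tendsto (fun k => F k v) atTop (𝓝 (h v))) : IsGaussExponent h := by
  refine ⟨fun v => ge_of_tendsto' (hl v) fun k => (hF k).1 v, fun t ht => ?_⟩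
  refine IsGaussMix.lim _ _ 1 (fun k => (hF k).2 t ht) (fun k v => ?_) fun v => ?_
  · exact exp_le_one_iff.2 (neg_nonpos.2 (mul_nonneg ht ((hF k).1 v)))
  · exact (continuous_exp.tendsto _).comp ((hl v).const_mul t).neg

lemma linear_sq (a b : ℝ) : IsGaussExponent fun v => (a * v 0 + b * v 1) ^ 2 := by
  refine ⟨fun v => sq_nonneg _, fun t ht => ?_⟩
  convert IsGaussMix.gauss (t * a ^ 2) (2 * t * a * b) (t * b ^ 2) ?_ using 2
  · ring_nf
  · intro x y
    have := mul_nonneg ht (sq_nonneg (a * x + b * y))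
    linarith

lemma rpow_of_le (hh : IsGaussExponent h) {η : ℝ} (hη : 0 < η) (hle : ∀ v, η ≤ h v)
    {α : ℝ} (h0 : 0 < α) (h1 : α ≤ 1) : IsGaussExponent fun v => h v ^ α := by
  refine ⟨fun v => rpow_nonneg (hh.1 v) _, fun t ht => ?_⟩
  rcases ht.eq_or_lt with rfl | ht
  · simpa using IsGaussMix.const zero_le_one
  set δ : ℕ → ℝ := fun m => (t / (m + 1)) ^ α⁻¹ with hδ
  have hδpos : ∀ m, 0 < δ m := fun m => by positivity
  have hδα : ∀ m, δ m ^ α = t / (m + 1) := fun m => by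
    rw [hδ, ← rpow_mul (by positivity), inv_mul_cancel₀ h0.ne', rpow_one]
  have hδ0 : Tendsto δ atTop (𝓝 0) := by
    have h2 : Tendsto (fun m : ℕ => t / ((m : ℝ) + 1)) atTop (𝓝 0) :=
      tendsto_const_nhds.div_atTop (tendsto_natCast_atTop_atTop.atTop_add tendsto_const_nhds)
    have h3 := h2.rpow_const (p := α⁻¹) (Or.inr (by positivity))
    rwa [zero_rpow (by positivity)] at h3
  have hmix : ∀ m, IsGaussMix fun v => 1 - (1 - exp (-(δ m * h v))) ^ α := fun m =>
    (hh.2 _ (hδpos m).le).one_sub_one_sub_rpow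
      (fun v => Real.exp_lt_one_iff.2 (neg_lt_zero.2 (mul_pos (hδpos m) (hη.trans_le (hle v)))))
      h0.le h1
  refine IsGaussMix.lim (fun m v => (1 - (1 - exp (-(δ m * h v))) ^ α) ^ (m + 1)) _ 1
    (fun m => (hmix m).pow _) (fun m v => ?_) fun v => ?_
  · refine pow_le_one₀ ((hmix m).nonneg v) ?_
    have : 0 ≤ (1 - exp (-(δ m * h v))) ^ α :=
      rpow_nonneg (sub_nonneg.2 (exp_le_one_iff.2 (neg_nonpos.2
        (mul_nonneg (hδpos m).le (hh.1 v))))) _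
    linarith
  · have hv : 0 < h v := hη.trans_le (hle v)
    have hd : HasDerivAt (fun s => 1 - exp (-(s * h v))) (h v) 0 := by
      have := ((((hasDerivAt_id (0 : ℝ)).mul_const (h v)).neg).exp).const_sub 1
      simpa using this
    have hq : Tendsto (fun m => (1 - exp (-(δ m * h v))) / δ m) atTop (𝓝 (h v)) := by
      have := hd.tendsto_slope.comp (tendsto_nhdsWithin_iff.2 ⟨hδ0, Eventually.of_forall
        fun m => (hδpos m).ne'⟩)
      refine this.congr fun m => ?_
      simp [slope_def_field]
    have hlim : Tendsto (fun m : ℕ => ((m : ℝ) + 1) * (1 - exp (-(δ m * h v))) ^ α) atTop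
        (𝓝 (t * h v ^ α)) := by
      refine ((hq.rpow_const (Or.inl hv.ne')).const_mul t).congr fun m => ?_
      have hnn : 0 ≤ 1 - exp (-(δ m * h v)) := sub_nonneg.2 (exp_le_one_iff.2 (neg_nonpos.2
        (mul_nonneg (hδpos m).le (hh.1 v))))
      rw [div_rpow hnn (hδpos m).le, hδα]
      field_simp
    have key : Tendsto (fun m : ℕ => (1 + -(1 - exp (-(δ (m - 1) * h v))) ^ α) ^ m) atTop
        (𝓝 (exp (-(t * h v ^ α)))) := by
      apply tendsto_one_add_pow_exp_of_tendsto
      rw [← tendsto_add_atTop_iff_nat 1]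
      refine hlim.neg.congr fun m => ?_
      simp
    refine ((tendsto_add_atTop_iff_nat 1).2 key).congr fun m => ?_
    simp [sub_eq_add_neg]

lemma rpow (hh : IsGaussExponent h) {α : ℝ} (h0 : 0 < α) (h1 : α ≤ 1) :
    IsGaussExponent fun v => h v ^ α := by
  refine lim (fun k v => (h v + 1 / ((k : ℝ) + 1)) ^ α) (fun k => ?_) fun v => ?_
  · have hk : (0 : ℝ) < 1 / ((k : ℝ) + 1) := by positivity
    exact (hh.add (const hk.le)).rpow_of_le hk (fun v => by linarith [hh.1 v]) h0 h1
  · have := (tendsto_one_div_add_atTop_nhds_zero_nat (𝕜 := ℝ)).const_add (h v)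
    rw [add_zero] at this
    exact this.rpow_const (Or.inr h0.le)

lemma abs_linear (a b : ℝ) : IsGaussExponent fun v => |a * v 0 + b * v 1| := by
  convert (linear_sq a b).rpow (α := 1 / 2) (by norm_num) (by norm_num) using 2 with v
  rw [← sqrt_eq_rpow, sqrt_sq_eq_abs]

end IsGaussExponent

lemma sum_second_diff_mul (a : ℕ → ℝ) (x : ℝ) (l : ℕ) :
    ∑ j ∈ Finset.range l, (a (j + 2) - 2 * a (j + 1) + a j) * (x - (j + 1)) =
      (x - l - 1) * (a (l + 1) - a l) + a (l + 1) - a 0 - x * (a 1 - a 0) := by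
  induction l with
  | zero => simp
            ring
  | succ l ih =>
    rw [Finset.sum_range_succ, ih]
    push_cast
    ring

lemma sum_second_diff_mul_abs (a : ℕ → ℝ) (l i : ℕ) (hi : i ≤ l + 1) :
    ∑ j ∈ Finset.range l, (a (j + 2) - 2 * a (j + 1) + a j) * |(i : ℝ) - (j + 1)| =
      2 * a i - a 0 - a (l + 1) + (l + 1 - i) * (a (l + 1) - a l) - i * (a 1 - a 0) := by
  have top : ∀ l : ℕ, ∑ j ∈ Finset.range l,
      (a (j + 2) - 2 * a (j + 1) + a j) * |((l + 1 : ℕ) : ℝ) - (j + 1)| =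
      2 * a (l + 1) - a 0 - a (l + 1) + (l + 1 - (l + 1 : ℕ)) * (a (l + 1) - a l) -
        (l + 1 : ℕ) * (a 1 - a 0) := by
    intro l
    rw [Finset.sum_congr rfl fun j hj => ?_, sum_second_diff_mul a ((l + 1 : ℕ) : ℝ) l]
    · push_cast
      ring
    · rw [abs_of_nonneg]
      have : (j : ℝ) + 1 ≤ l := by exact_mod_cast Finset.mem_range.1 hj
      push_cast
      linarith
  induction l with
  | zero =>
    rcases Nat.le_one_iff_eq_zero_or_eq_one.1 hi with rfl | rfl
    · simp
      ring
    · simp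
      ring
  | succ l ih =>
    rcases hi.eq_or_lt with rfl | hi
    · exact_mod_cast top (l + 1)
    · have hi' : i ≤ l + 1 := Nat.lt_succ_iff.1 hi
      have : (i : ℝ) ≤ l + 1 := by exact_mod_cast hi'
      rw [Finset.sum_range_succ, ih hi', abs_of_nonpos (by linarith)]
      push_cast
      ring

namespace IsNormOn

variable {m : ℕ} {N : (Fin m → ℝ) → ℝ}

lemma neg (hN : IsNormOn m N) (x : Fin m → ℝ) : N (-x) = N x := by
  have := hN.2.1 (-1) x
  simpa using this

lemma nonneg (hN : IsNormOn m N) (x : Fin m → ℝ) : 0 ≤ N x := by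
  have h := hN.2.2 x (-x)
  rw [add_neg_cancel, (hN.1 0).2 rfl, hN.neg] at h
  linarith

lemma sub_le (hN : IsNormOn m N) (x y : Fin m → ℝ) : N x - N y ≤ N (x - y) := by
  have h := hN.2.2 (x - y) y
  rw [sub_add_cancel] at h
  linarith

lemma smul_of_nonneg (hN : IsNormOn m N) {a : ℝ} (ha : 0 ≤ a) (x : Fin m → ℝ) :
    N (a • x) = a * N x := by
  rw [hN.2.1, abs_of_nonneg ha]

lemma slope_le (hN : IsNormOn m N) (e w : Fin m → ℝ) {s t : ℝ} (hst : s ≤ t) :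
    N (t • e + w) - N (s • e + w) ≤ (t - s) * N e := by
  refine (hN.sub_le _ _).trans_eq ?_
  rw [← hN.smul_of_nonneg (sub_nonneg.2 hst)]
  congr 1
  module

lemma le_slope (hN : IsNormOn m N) (e w : Fin m → ℝ) {d T : ℝ} (hd : 0 ≤ d) (hT : 0 < T)
    (hdT : d ≤ T) :
    d * (N e - 2 * N w / T) ≤ N (T • e + w) - N ((T - d) • e + w) := by
  have h1 : N ((T - d) • e + w) ≤ (1 - d / T) * N (T • e + w) + d / T * N w := by
    have : (T - d) • e + w = (1 - d / T) • (T • e + w) + (d / T) • w := by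
      ext i
      simp only [Pi.add_apply, Pi.smul_apply, smul_eq_mul]
      field_simp
      ring
    rw [this, ← hN.smul_of_nonneg (sub_nonneg.2 ((div_le_one hT).2 hdT)),
      ← hN.smul_of_nonneg (div_nonneg hd hT.le)]
    exact hN.2.2 _ _
  have h2 : T * N e - N w ≤ N (T • e + w) := by
    have := hN.sub_le (T • e) (-w)
    rwa [hN.neg, hN.smul_of_nonneg hT.le, sub_neg_eq_add] at this
  have h3 : d / T * (T * N e - N w) ≤ d / T * N (T • e + w) :=
    mul_le_mul_of_nonneg_left h2 (div_nonneg hd hT.le)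
  have h4 : d * (N e - 2 * N w / T) = d / T * (T * N e - N w) - d / T * N w := by
    field_simp
    ring
  linarith

/-- A norm on the plane is, up to an error that vanishes in the limit, a nonnegative combination
of absolute values of linear forms. -/
lemma exists_approx {N : (Fin 2 → ℝ) → ℝ} (hN : IsNormOn 2 N) (K : ℕ) (hK : 0 < K) :
    ∃ F : (Fin 2 → ℝ) → ℝ, IsGaussExponent F ∧ ∀ v : Fin 2 → ℝ, |v 0| ≤ K * |v 1| ∨ v 1 = 0 →
      |F v - N v| ≤ (2 * N ![1, 0] * |v 1| + 2 * N ![0, 1] * (|v 0| + |v 1|)) / K := by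
  set e : Fin 2 → ℝ := ![1, 0] with he
  set w : Fin 2 → ℝ := ![0, 1] with hw
  set α := N e with hα
  set β := N w with hβ
  have hα0 : 0 ≤ α := hN.nonneg _
  have hβ0 : 0 ≤ β := hN.nonneg _
  have hKr : (0 : ℝ) < K := by exact_mod_cast hK
  have hK1 : (1 : ℝ) ≤ K := by exact_mod_cast hK
  obtain ⟨l, hl⟩ : ∃ l, l + 1 = 2 * K ^ 2 := ⟨2 * K ^ 2 - 1, by
    have : 0 < K ^ 2 := by positivity
    omega⟩
  have hlr : (l : ℝ) + 1 = 2 * K ^ 2 := by exact_mod_cast hl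
  set g : ℝ → ℝ := fun u => N (u • e + w) with hg
  have hg' : ∀ u, N (u • -e + w) = g (-u) := fun u => by
    simp only [hg, smul_neg, neg_smul]
  set t : ℕ → ℝ := fun j => j / K - K with ht
  have ht0 : t 0 = -K := by simp [ht]
  have htl : t (l + 1) = K := by
    simp only [ht, Nat.cast_add, Nat.cast_one, hlr]
    field_simp
    ring
  have htl' : t l = K - 1 / K := by
    have : t l = t (l + 1) - 1 / K := by
      simp only [ht, Nat.cast_add, Nat.cast_one]
      ring
    rw [this, htl]
  have ht1 : t 1 = -(K - 1 / K) := by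
    simp only [ht, Nat.cast_one]
    ring
  have htd : ∀ i j : ℕ, t i - t j = (i - j) / K := fun i j => by
    simp only [ht]
    ring
  set a : ℕ → ℝ := fun j => g (t j) with ha
  set p := K * (a (l + 1) - a l) with hp
  set q := K * (a 0 - a 1) with hq
  have hd : (0 : ℝ) ≤ 1 / K := by positivity
  have hdK : 1 / (K : ℝ) ≤ K := (div_le_one hKr).2 hK1 |>.trans hK1
  have cancel : ∀ x : ℝ, K * (1 / K * x) = x := fun x => by field_simp
  have hpu : p ≤ α := by
    have := mul_le_mul_of_nonneg_left
      (hN.slope_le e w (sub_le_self (K : ℝ) hd)) hKr.le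
    rw [sub_sub_cancel, cancel] at this
    simpa only [hp, ha, htl, htl'] using this
  have hqu : q ≤ α := by
    have := mul_le_mul_of_nonneg_left
      (hN.slope_le (-e) w (sub_le_self (K : ℝ) hd)) hKr.le
    rw [sub_sub_cancel, cancel, hN.neg, hg', hg'] at this
    simpa only [hq, ha, ht0, ht1] using this
  have hpl : α - 2 * β / K ≤ p := by
    have := mul_le_mul_of_nonneg_left
      (hN.le_slope e w hd hKr hdK) hKr.le
    rw [cancel] at this
    simpa only [hp, ha, htl, htl'] using this
  have hql : α - 2 * β / K ≤ q := by
    have := mul_le_mul_of_nonneg_left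
      (hN.le_slope (-e) w hd hKr hdK) hKr.le
    rw [cancel, hN.neg, hg', hg'] at this
    simpa only [hq, ha, ht0, ht1] using this
  set c : ℕ → ℝ := fun j => K / 2 * (a (j + 2) - 2 * a (j + 1) + a j) with hc
  have hc0 : ∀ j, 0 ≤ c j := fun j => by
    have h1 := hN.2.2 (t (j + 2) • e + w) (t j • e + w)
    have h2 : t (j + 2) • e + w + (t j • e + w) =
        (2 : ℝ) • (t (j + 1) • e + w) := by
      have : t (j + 2) = 2 * t (j + 1) - t j := by
        simp only [ht]
        push_cast
        ring
      rw [this]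
      module
    rw [h2, hN.smul_of_nonneg zero_le_two] at h1
    exact mul_nonneg (by positivity) (by simp only [ha, hg]; linarith)
  set γ := (a 0 + a (l + 1)) / 2 - K * (p + q) / 2 with hγ
  have hγ0 : 0 ≤ γ := by
    have h1 := hN.2.2 ((K : ℝ) • e + w) (-(-(K : ℝ) • e + w))
    have h2 : (K : ℝ) • e + w + -(-(K : ℝ) • e + w) =
        (2 * K : ℝ) • e := by
      module
    rw [h2, hN.neg, hN.smul_of_nonneg (by positivity)] at h1
    have h3 : 2 * K * α ≤ a (l + 1) + a 0 := by
      simpa only [ha, htl, ht0] using h1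
    have h4 : K * (p + q) ≤ K * (α + α) := mul_le_mul_of_nonneg_left (add_le_add hpu hqu) hKr.le
    rw [hγ]
    linarith
  have hsum : ∑ j ∈ Finset.range l, c j = (p + q) / 2 := by
    have h1 := sum_second_diff_mul a 1 l
    have h2 := sum_second_diff_mul a 0 l
    have h3 : ∑ j ∈ Finset.range l, (a (j + 2) - 2 * a (j + 1) + a j) =
        (a (l + 1) - a l) + (a 0 - a 1) := by
      have := congrArg₂ (· - ·) h1 h2
      simp only [← Finset.sum_sub_distrib, ← mul_sub] at this
      simp only [sub_sub_sub_cancel_right, sub_zero, mul_one] at this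
      rw [this]
      ring
    simp only [hc, ← Finset.mul_sum, h3, hp, hq]
    ring
  have hgrid : ∀ i ≤ l + 1, ∑ j ∈ Finset.range l, c j * |t i - t (j + 1)| =
      a i - γ - (p - q) / 2 * t i := by
    intro i hi
    have h1 := sum_second_diff_mul_abs a l i hi
    have h2 : ∀ j ∈ Finset.range l, c j * |t i - t (j + 1)| =
        1 / 2 * ((a (j + 2) - 2 * a (j + 1) + a j) * |(i : ℝ) - (j + 1)|) := fun j _ => by
      rw [htd, abs_div, abs_of_pos hKr, hc]
      push_cast
      field_simp
    rw [Finset.sum_congr rfl h2, ← Finset.mul_sum, h1, hlr, hγ, hp, hq, ht]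
    field_simp
    ring
  refine ⟨fun v => ∑ j ∈ Finset.range l, c j * |1 * v 0 + -t (j + 1) * v 1| +
    γ * |0 * v 0 + 1 * v 1|, ?_, fun v hv => ?_⟩
  · exact (IsGaussExponent.sum _ _ fun j _ => (IsGaussExponent.abs_linear _ _).smul (hc0 j)).add
      ((IsGaussExponent.abs_linear _ _).smul hγ0)
  by_cases hv1 : v 1 = 0
  · have hNv : N v = |v 0| * α := by
      rw [hα, ← hN.2.1]
      congr 1
      ext i
      fin_cases i <;> simp [hv1, he]
    simp only [hv1, mul_zero, add_zero, abs_zero, ← Finset.sum_mul, hsum, hNv, zero_mul, one_mul,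
      zero_add]
    have : (p + q) / 2 * |v 0| - |v 0| * α = -((α - (p + q) / 2) * |v 0|) := by ring
    rw [this, abs_neg, abs_of_nonneg (mul_nonneg (by linarith) (abs_nonneg _)), mul_div_right_comm]
    exact mul_le_mul_of_nonneg_right (by linarith) (abs_nonneg _)
  have hv' : |v 0| ≤ K * |v 1| := hv.resolve_right hv1
  have hv1p : 0 < |v 1| := abs_pos.2 hv1
  obtain ⟨u, hu⟩ : ∃ u, v 0 = u * v 1 := ⟨v 0 / v 1, (div_mul_cancel₀ _ hv1).symm⟩
  have huK : |u| ≤ K := by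
    rw [hu, abs_mul] at hv'
    exact le_of_mul_le_mul_right hv' hv1p
  have hNv : N v = |v 1| * g u := by
    rw [hg, ← hN.2.1]
    congr 1
    ext i
    fin_cases i
    · simp [hu, he, hw, mul_comm]
    · simp [he, hw]
  have hFv : ∑ j ∈ Finset.range l, c j * |1 * v 0 + -t (j + 1) * v 1| + γ * |0 * v 0 + 1 * v 1| =
      |v 1| * (∑ j ∈ Finset.range l, c j * |u - t (j + 1)| + γ) := by
    simp only [mul_add, Finset.mul_sum, zero_mul, zero_add, one_mul, mul_comm γ]
    congr 1
    refine Finset.sum_congr rfl fun j _ => ?_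
    rw [hu, neg_mul, ← sub_eq_add_neg, ← sub_mul, abs_mul]
    ring
  have hnn : 0 ≤ (u + K) * K := mul_nonneg (by linarith [neg_le_of_abs_le huK]) hKr.le
  set i := ⌊(u + K) * K⌋₊ with hi
  have hi1 : (i : ℝ) ≤ (u + K) * K := Nat.floor_le hnn
  have hi2 : (u + K) * K < i + 1 := Nat.lt_floor_add_one _
  have hil : i ≤ l + 1 := by
    have : (i : ℝ) ≤ (l + 1 : ℕ) := by
      push_cast
      rw [hlr]
      nlinarith [le_of_abs_le huK]
    exact_mod_cast this
  have hti1 : t i ≤ u := by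
    simp only [ht]
    rw [sub_le_iff_le_add, div_le_iff₀ hKr]
    exact hi1
  have hti2 : u ≤ t i + 1 / K := by
    simp only [ht]
    rw [sub_add_eq_add_sub, ← add_div, le_sub_iff_add_le, le_div_iff₀ hKr]
    exact hi2.le
  have habs : |u - t i| ≤ 1 / K := by
    rw [abs_of_nonneg (by linarith)]
    linarith
  have hgu : |g u - g (t i)| ≤ α * (1 / K) := by
    have h1 : ∀ s s' : ℝ, g s - g s' ≤ |s - s'| * α := fun s s' => by
      refine (hN.sub_le _ _).trans_eq ?_
      rw [hα, ← hN.2.1]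
      congr 1
      module
    rw [abs_le]
    have h2 := h1 u (t i)
    have h3 := h1 (t i) u
    rw [abs_sub_comm] at h3
    have h4 : |u - t i| * α ≤ 1 / K * α := mul_le_mul_of_nonneg_right habs hα0
    constructor <;> linarith
  have hGu : |((∑ j ∈ Finset.range l, c j * |u - t (j + 1)|) -
      ∑ j ∈ Finset.range l, c j * |t i - t (j + 1)| : ℝ)| ≤ α * (1 / K) := by
    rw [← Finset.sum_sub_distrib]
    refine (Finset.abs_sum_le_sum_abs _ _).trans ?_
    have : ∀ j ∈ Finset.range l, |(c j * |u - t (j + 1)| - c j * |t i - t (j + 1)| : ℝ)| ≤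
        c j * (1 / K) := fun j _ => by
      rw [← mul_sub, abs_mul, abs_of_nonneg (hc0 j)]
      refine mul_le_mul_of_nonneg_left ((abs_abs_sub_abs_le _ _).trans ?_) (hc0 j)
      rwa [sub_sub_sub_cancel_right]
    refine (Finset.sum_le_sum this).trans ?_
    rw [← Finset.sum_mul, hsum]
    exact mul_le_mul_of_nonneg_right (by linarith) hd
  have hpq : |(p - q) / 2 * t i| ≤ 2 * β / K * (|u| + 1) := by
    rw [abs_mul]
    have h0 : 0 ≤ 2 * β / K := by positivity
    refine mul_le_mul ?_ ?_ (abs_nonneg _) h0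
    · rw [abs_le]
      constructor <;> linarith
    · have := abs_sub_abs_le_abs_sub (t i) u
      rw [abs_sub_comm (t i) u] at this
      have : 1 / (K : ℝ) ≤ 1 := (div_le_one hKr).2 hK1
      linarith
  have hfin : |∑ j ∈ Finset.range l, c j * |u - t (j + 1)| + γ - g u| ≤
      (2 * α + 2 * β * (|u| + 1)) / K := by
    have h1 := hgrid i hil
    have h2 : a i = g (t i) := rfl
    have h3 : (2 * α + 2 * β * (|u| + 1)) / K =
        α * (1 / K) + α * (1 / K) + 2 * β / K * (|u| + 1) := by
      ring
    rw [h3]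
    rw [abs_le] at hgu hGu hpq ⊢
    constructor <;> linarith
  beta_reduce
  rw [hFv, hNv, ← mul_sub, abs_mul, abs_abs, hu, abs_mul]
  refine (mul_le_mul_of_nonneg_left hfin hv1p.le).trans_eq ?_
  ring

lemma isGaussExponent {N : (Fin 2 → ℝ) → ℝ} (hN : IsNormOn 2 N) : IsGaussExponent N := by
  choose F hF hFN using fun k : ℕ => hN.exists_approx (k + 1) k.succ_pos
  refine IsGaussExponent.lim F hF fun v => ?_
  rw [tendsto_iff_norm_sub_tendsto_zero]
  refine squeeze_zero' (g := fun k : ℕ =>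
    (2 * N ![1, 0] * |v 1| + 2 * N ![0, 1] * (|v 0| + |v 1|)) / ((k + 1 : ℕ) : ℝ))
    (Eventually.of_forall fun k => norm_nonneg _) ?_ ?_
  · obtain ⟨k₀, hk₀⟩ := exists_nat_ge (|v 0| / |v 1|)
    filter_upwards [eventually_ge_atTop k₀] with k hk
    refine hFN k v ?_
    by_cases hv : v 1 = 0
    · exact Or.inr hv
    · left
      rw [← div_le_iff₀ (abs_pos.2 hv)]
      refine hk₀.trans ?_
      exact_mod_cast hk.trans k.le_succ
  · exact tendsto_const_nhds.div_atTop
      (tendsto_natCast_atTop_atTop.comp (tendsto_add_atTop_nat 1))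

end IsNormOn

lemma integrable_exp_neg_normSq {ε : ℝ} (hε : 0 < ε) :
    Integrable fun v : Fin 2 → ℝ => exp (-(ε * (v 0 ^ 2 + v 1 ^ 2))) := by
  have h := (integrable_exp_neg_mul_sq hε).mul_prod (integrable_exp_neg_mul_sq hε)
  have h2 := ((volume_preserving_finTwoArrow ℝ).integrable_comp_emb
    MeasurableEquiv.finTwoArrow.measurableEmbedding).2 h
  refine h2.congr (Eventually.of_forall fun v => ?_)
  change exp _ * exp _ = _
  rw [← exp_add]
  congr 1
  change -ε * v 0 ^ 2 + -ε * v 1 ^ 2 = _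
  ring

/-- The cosine transform of a Gaussian on the plane is a Gaussian. -/
lemma exists_integral_gauss_mul_cos {A b C ε : ℝ} (hε : 0 < ε)
    (h : ∀ x y : ℝ, ε * (x ^ 2 + y ^ 2) ≤ A * x ^ 2 + b * (x * y) + C * y ^ 2) (ξ : Fin 2 → ℝ) :
    ∃ K Q : ℝ, 0 ≤ K ∧ ∀ r : ℝ,
      ∫ v : Fin 2 → ℝ, exp (-(A * v 0 ^ 2 + b * (v 0 * v 1) + C * v 1 ^ 2)) *
        cos (r * (v 0 * ξ 0 + v 1 * ξ 1)) = K * exp (-(Q * r ^ 2)) := by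
  have hC : 0 < C := by linarith [h 0 1]
  set D := A - b ^ 2 / (4 * C) with hD
  have hD0 : 0 < D := by
    have h1 := h 1 (-b / (2 * C))
    have h2 : A * 1 ^ 2 + b * (1 * (-b / (2 * C))) + C * (-b / (2 * C)) ^ 2 = D := by
      rw [hD]
      field_simp
      ring
    rw [h2] at h1
    nlinarith [sq_nonneg (-b / (2 * C))]
  set Q := ξ 1 ^ 2 / (4 * C) + (ξ 0 - b * ξ 1 / (2 * C)) ^ 2 / (4 * D) with hQ
  set K : ℂ := ((π : ℂ) / -(-C : ℂ)) ^ (1 / 2 : ℂ) * ((π : ℂ) / -(-D : ℂ)) ^ (1 / 2 : ℂ) with hK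
  have hmain : ∀ r : ℝ,
      ∫ v : Fin 2 → ℝ, exp (-(A * v 0 ^ 2 + b * (v 0 * v 1) + C * v 1 ^ 2)) *
        cos (r * (v 0 * ξ 0 + v 1 * ξ 1)) = K.re * exp (-(Q * r ^ 2)) := by
    intro r
    set F : ℝ × ℝ → ℂ := fun z => Complex.exp (-C * (z.2 : ℂ) ^ 2 +
      (-b * z.1 + Complex.I * (r * ξ 1)) * z.2 +
        (-A * (z.1 : ℂ) ^ 2 + Complex.I * (r * ξ 0) * z.1)) with hF
    have hFe : ∀ z, F z = Complex.exp ((-(A * z.1 ^ 2 + b * (z.1 * z.2) + C * z.2 ^ 2) : ℝ) +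
        (r * (z.1 * ξ 0 + z.2 * ξ 1) : ℝ) * Complex.I) := fun z => by
      simp only [hF]
      congr 1
      push_cast
      ring
    have hFre : ∀ z, (F z).re = exp (-(A * z.1 ^ 2 + b * (z.1 * z.2) + C * z.2 ^ 2)) *
        cos (r * (z.1 * ξ 0 + z.2 * ξ 1)) := fun z => by
      rw [hFe, Complex.exp_re]
      simp only [Complex.add_re, Complex.add_im, Complex.re_ofReal_mul, Complex.im_ofReal_mul,
        Complex.I_re, Complex.I_im, Complex.ofReal_re, Complex.ofReal_im, mul_zero, mul_one,
        add_zero, zero_add]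
    have hFn : ∀ z, ‖F z‖ ≤ exp (-ε * z.1 ^ 2) * exp (-ε * z.2 ^ 2) := fun z => by
      rw [hFe, Complex.norm_exp, ← exp_add]
      refine exp_le_exp.2 ?_
      simp only [Complex.add_re, Complex.re_ofReal_mul, Complex.I_re, Complex.ofReal_re, mul_zero,
        add_zero]
      linarith [h z.1 z.2]
    have hFi : Integrable F := by
      refine ((integrable_exp_neg_mul_sq hε).mul_prod (integrable_exp_neg_mul_sq hε)).mono'
        ?_ (Eventually.of_forall hFn)
      exact (by fun_prop : Continuous F).aestronglyMeasurable
    have h1 : ∫ z, F z = K * Complex.exp ((-(Q * r ^ 2) : ℝ)) := by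
      rw [Measure.volume_eq_prod, integral_prod F hFi]
      have h2 : ∀ x : ℝ, ∫ y : ℝ, F (x, y) = ((π : ℂ) / -(-C : ℂ)) ^ (1 / 2 : ℂ) *
          Complex.exp (-D * (x : ℂ) ^ 2 + (Complex.I * (r * (ξ 0 - b * ξ 1 / (2 * C)))) * x +
            -(r * ξ 1) ^ 2 / (4 * C)) := fun x => by
        have := integral_cexp_quadratic (b := (-C : ℂ)) (by simpa using hC)
          (-b * x + Complex.I * (r * ξ 1)) (-A * (x : ℂ) ^ 2 + Complex.I * (r * ξ 0) * x)
        simp only [hF]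
        rw [this]
        congr 2
        have hC' : (C : ℂ) ≠ 0 := by exact_mod_cast hC.ne'
        rw [hD]
        push_cast
        field_simp
        linear_combination 2 * (r * ξ 1 : ℂ) ^ 2 * Complex.I_sq
      simp only [h2]
      rw [integral_const_mul, integral_cexp_quadratic (b := (-D : ℂ)) (by simpa using hD0), hK,
        mul_assoc]
      congr 3
      have hC' : (C : ℂ) ≠ 0 := by exact_mod_cast hC.ne'
      have hD' : (D : ℂ) ≠ 0 := by exact_mod_cast hD0.ne'
      rw [hQ]
      push_cast
      rw [mul_pow Complex.I, Complex.I_sq]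
      field_simp
      ring
    have h3 : ∫ v : Fin 2 → ℝ, exp (-(A * v 0 ^ 2 + b * (v 0 * v 1) + C * v 1 ^ 2)) *
        cos (r * (v 0 * ξ 0 + v 1 * ξ 1)) = ∫ z, (F z).re := by
      rw [← (volume_preserving_finTwoArrow ℝ).integral_comp']
      refine integral_congr_ae (Eventually.of_forall fun v => ?_)
      beta_reduce
      rw [hFre]
      rfl
    rw [h3]
    refine (integral_re hFi).trans ?_
    rw [h1, ← Complex.ofReal_exp]
    exact Complex.re_mul_ofReal _ _
  refine ⟨K.re, Q, ?_, hmain⟩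
  have := hmain 0
  simp only [zero_mul, cos_zero, mul_one, ne_eq, OfNat.ofNat_ne_zero, not_false_eq_true, zero_pow,
    mul_zero, neg_zero, exp_zero] at this
  rw [← this]
  exact integral_nonneg fun v => (exp_pos _).le

/-- `g` is nonnegative and log-convex (in the multiplicative form) on `[0, ∞)`. -/
def IsLogConvex (g : ℝ → ℝ) : Prop :=
  (∀ s, 0 ≤ s → 0 ≤ g s) ∧ ∀ s t a b : ℝ, 0 ≤ s → 0 ≤ t → 0 < a → 0 < b → a + b = 1 →
    g (a * s + b * t) ≤ g s ^ a * g t ^ b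

lemma rpow_mul_rpow_add_le {x y z w a b : ℝ} (hx : 0 ≤ x) (hy : 0 ≤ y) (hz : 0 ≤ z) (hw : 0 ≤ w)
    (ha : 0 < a) (hb : 0 < b) (hab : a + b = 1) :
    x ^ a * y ^ b + z ^ a * w ^ b ≤ (x + z) ^ a * (y + w) ^ b := by
  rcases (add_nonneg hx hz).eq_or_lt with h | h
  · have hx0 : x = 0 := by linarith
    have hz0 : z = 0 := by linarith
    simp [hx0, hz0, zero_rpow ha.ne']
  rcases (add_nonneg hy hw).eq_or_lt with h' | h'
  · have hy0 : y = 0 := by linarith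
    have hw0 : w = 0 := by linarith
    simp [hy0, hw0, zero_rpow hb.ne']
  have h1 := geom_mean_le_arith_mean2_weighted ha.le hb.le (div_nonneg hx h.le)
    (div_nonneg hy h'.le) hab
  have h2 := geom_mean_le_arith_mean2_weighted ha.le hb.le (div_nonneg hz h.le)
    (div_nonneg hw h'.le) hab
  rw [div_rpow hx h.le, div_rpow hy h'.le] at h1
  rw [div_rpow hz h.le, div_rpow hw h'.le] at h2
  have hX : 0 < (x + z) ^ a := rpow_pos_of_pos h _
  have hY : 0 < (y + w) ^ b := rpow_pos_of_pos h' _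
  have h3 : a * (x / (x + z)) + b * (y / (y + w)) + (a * (z / (x + z)) + b * (w / (y + w)))
      = 1 := by
    rw [← hab]
    field_simp
    ring
  have h4 : x ^ a / (x + z) ^ a * (y ^ b / (y + w) ^ b) +
      z ^ a / (x + z) ^ a * (w ^ b / (y + w) ^ b) ≤ 1 := by linarith
  rw [div_mul_div_comm, div_mul_div_comm, ← add_div, div_le_one (mul_pos hX hY)] at h4
  exact h4

namespace IsLogConvex

variable {g h : ℝ → ℝ}

lemma const_mul_exp {K : ℝ} (hK : 0 ≤ K) (Q : ℝ) : IsLogConvex fun s => K * exp (-(Q * s)) := by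
  refine ⟨fun s _ => mul_nonneg hK (exp_pos _).le, fun s t a b _ _ ha hb hab => le_of_eq ?_⟩
  beta_reduce
  rw [mul_rpow hK (exp_pos _).le, mul_rpow hK (exp_pos _).le, mul_mul_mul_comm,
    ← rpow_add' hK (by rw [hab]; exact one_ne_zero), hab, rpow_one, ← exp_mul, ← exp_mul, ← exp_add]
  congr 2
  ring

lemma const {K : ℝ} (hK : 0 ≤ K) : IsLogConvex fun _ => K := by
  simpa using const_mul_exp hK 0

lemma add (hg : IsLogConvex g) (hh : IsLogConvex h) : IsLogConvex fun s => g s + h s :=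
  ⟨fun s hs => add_nonneg (hg.1 s hs) (hh.1 s hs), fun s t a b hs ht ha hb hab =>
    (add_le_add (hg.2 s t a b hs ht ha hb hab) (hh.2 s t a b hs ht ha hb hab)).trans
      (rpow_mul_rpow_add_le (hg.1 s hs) (hg.1 t ht) (hh.1 s hs) (hh.1 t ht) ha hb hab)⟩

lemma smul {r : ℝ} (hr : 0 ≤ r) (hg : IsLogConvex g) : IsLogConvex fun s => r * g s := by
  refine ⟨fun s hs => mul_nonneg hr (hg.1 s hs), fun s t a b hs ht ha hb hab => ?_⟩
  rw [mul_rpow hr (hg.1 s hs), mul_rpow hr (hg.1 t ht), mul_mul_mul_comm,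
    ← rpow_add' hr (by rw [hab]; exact one_ne_zero), hab, rpow_one]
  exact mul_le_mul_of_nonneg_left (hg.2 s t a b hs ht ha hb hab) hr

lemma lim (G : ℕ → ℝ → ℝ) (hG : ∀ k, IsLogConvex (G k))
    (hlim : ∀ s, 0 ≤ s → Tendsto (fun k => G k s) atTop (𝓝 (g s))) : IsLogConvex g := by
  refine ⟨fun s hs => ge_of_tendsto' (hlim s hs) fun k => (hG k).1 s hs,
    fun s t a b hs ht ha hb hab => ?_⟩
  exact le_of_tendsto_of_tendsto' (hlim _ (by positivity))
    (((hlim s hs).rpow_const (Or.inr ha.le)).mul ((hlim t ht).rpow_const (Or.inr hb.le)))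
    fun k => (hG k).2 s t a b hs ht ha hb hab

lemma congr (hg : IsLogConvex g) (hgh : ∀ s, 0 ≤ s → h s = g s) : IsLogConvex h := by
  refine ⟨fun s hs => (hg.1 s hs).trans_eq (hgh s hs).symm, fun s t a b hs ht ha hb hab => ?_⟩
  rw [hgh s hs, hgh t ht, hgh _ (by positivity)]
  exact hg.2 s t a b hs ht ha hb hab

lemma le_rpow_mul_rpow (hg : IsLogConvex g) {a : ℝ} (ha0 : 0 ≤ a) (ha1 : a ≤ 1) :
    g a ≤ g 1 ^ a * g 0 ^ (1 - a) := by
  rcases ha0.eq_or_lt with rfl | ha0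
  · simp
  rcases ha1.eq_or_lt with rfl | ha1
  · simp
  simpa using hg.2 1 0 a (1 - a) zero_le_one le_rfl ha0 (sub_pos.2 ha1) (by ring)

lemma prod_le (hg : IsLogConvex g) {n : ℕ} (w : Fin n → ℝ) (hw0 : ∀ i, 0 ≤ w i)
    (hw : ∑ i, w i = 1) : ∏ i, g (w i) ≤ g 0 ^ (n - 1) * g 1 := by
  have hw1 : ∀ i, w i ≤ 1 := fun i =>
    hw ▸ Finset.single_le_sum (fun j _ => hw0 j) (Finset.mem_univ i)
  have hn : 1 ≤ n := by
    rcases n with _ | n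
    · simp at hw
    · omega
  refine (Finset.prod_le_prod (fun i _ => hg.1 _ (hw0 i))
    fun i _ => hg.le_rpow_mul_rpow (hw0 i) (hw1 i)).trans_eq ?_
  rw [Finset.prod_mul_distrib, ← rpow_sum_of_nonneg (hg.1 1 zero_le_one) fun i _ => hw0 i,
    ← rpow_sum_of_nonneg (hg.1 0 le_rfl) fun i _ => sub_nonneg.2 (hw1 i), Finset.sum_sub_distrib,
    hw, rpow_one, mul_comm, ← rpow_natCast, Nat.cast_sub hn]
  simp

lemma pow_le_prod_of_pos (hg : IsLogConvex g) (hpos : ∀ s, 0 ≤ s → 0 < g s) {n : ℕ}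
    (w : Fin n → ℝ) (hw0 : ∀ i, 0 ≤ w i) (hw : ∑ i, w i = 1) :
    g (1 / n) ^ n ≤ ∏ i, g (w i) := by
  have hn : (0 : ℝ) < n := by
    rcases n with _ | n
    · simp at hw
    · positivity
  have hconv : ConvexOn ℝ (Set.Ici 0) fun s => log (g s) := by
    refine convexOn_iff_forall_pos.2 ⟨convex_Ici 0, fun s hs t ht a b ha hb hab => ?_⟩
    have := log_le_log (hpos _ (add_nonneg (mul_nonneg ha.le hs) (mul_nonneg hb.le ht)))
      (hg.2 s t a b hs ht ha hb hab)
    rwa [log_mul (rpow_pos_of_pos (hpos s hs) _).ne' (rpow_pos_of_pos (hpos t ht) _).ne',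
      log_rpow (hpos s hs), log_rpow (hpos t ht)] at this
  have h := hconv.map_sum_le (t := Finset.univ) (w := fun _ : Fin n => 1 / (n : ℝ)) (p := w)
    (fun i _ => by positivity) (by simp [hn.ne']) fun i _ => hw0 i
  simp only [smul_eq_mul, ← Finset.mul_sum, hw, mul_one] at h
  have hn' : 0 ≤ 1 / (n : ℝ) := by positivity
  rw [← log_le_log_iff (pow_pos (hpos _ hn') _) (Finset.prod_pos fun i _ => hpos _ (hw0 i)),
    log_pow,
    log_prod fun i _ => (hpos _ (hw0 i)).ne']
  calc _ ≤ n * (1 / n * ∑ i, log (g (w i))) := mul_le_mul_of_nonneg_left h hn.le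
    _ = _ := by field_simp

lemma pow_le_prod (hg : IsLogConvex g) {n : ℕ} (w : Fin n → ℝ) (hw0 : ∀ i, 0 ≤ w i)
    (hw : ∑ i, w i = 1) : g (1 / n) ^ n ≤ ∏ i, g (w i) := by
  have hpos : ∀ η : ℝ, 0 < η → (g (1 / n) + η) ^ n ≤ ∏ i, (g (w i) + η) := fun η hη =>
    (hg.add (const hη.le)).pow_le_prod_of_pos (fun s hs => by linarith [hg.1 s hs]) w hw0 hw
  have h1 : Tendsto (fun η : ℝ => (g (1 / n) + η) ^ n) (𝓝[>] 0) (𝓝 ((g (1 / n) + 0) ^ n)) :=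
    ((by fun_prop : Continuous fun η : ℝ => (g (1 / n) + η) ^ n).tendsto 0).mono_left
      nhdsWithin_le_nhds
  have h2 : Tendsto (fun η : ℝ => ∏ i, (g (w i) + η)) (𝓝[>] 0) (𝓝 (∏ i, (g (w i) + 0))) :=
    ((by fun_prop : Continuous fun η : ℝ => ∏ i, (g (w i) + η)).tendsto 0).mono_left
      nhdsWithin_le_nhds
  simpa using le_of_tendsto_of_tendsto h1 h2 (eventually_mem_nhdsWithin.mono hpos)

end IsLogConvex

namespace IsGaussMix

variable {f : (Fin 2 → ℝ) → ℝ}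

lemma isLogConvex_of_exp_mul (hf : IsGaussMix f) {ε : ℝ} (hε : 0 < ε) (ξ : Fin 2 → ℝ) :
    IsLogConvex fun s => ∫ v : Fin 2 → ℝ, f v * exp (-(ε * (v 0 ^ 2 + v 1 ^ 2))) *
      cos (√s * (v 0 * ξ 0 + v 1 * ξ 1)) := by
  have hcos : ∀ s : ℝ, Measurable fun v : Fin 2 → ℝ => cos (√s * (v 0 * ξ 0 + v 1 * ξ 1)) :=
    fun s => by fun_prop
  have hexp : Measurable fun v : Fin 2 → ℝ => exp (-(ε * (v 0 ^ 2 + v 1 ^ 2))) := by fun_prop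
  have hbd : ∀ (f : (Fin 2 → ℝ) → ℝ) (C : ℝ) (s : ℝ) (v : Fin 2 → ℝ), 0 ≤ f v → f v ≤ C →
      ‖f v * exp (-(ε * (v 0 ^ 2 + v 1 ^ 2))) * cos (√s * (v 0 * ξ 0 + v 1 * ξ 1))‖ ≤
        C * exp (-(ε * (v 0 ^ 2 + v 1 ^ 2))) := fun f C s v h0 hC => by
    rw [norm_mul, norm_mul, norm_of_nonneg h0, norm_of_nonneg (exp_pos _).le]
    exact mul_le_of_le_one_right (by positivity) (abs_cos_le_one _) |>.trans
      (mul_le_mul_of_nonneg_right hC (exp_pos _).le)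
  have hInt : ∀ f : (Fin 2 → ℝ) → ℝ, IsGaussMix f → ∀ s : ℝ,
      Integrable fun v : Fin 2 → ℝ => f v * exp (-(ε * (v 0 ^ 2 + v 1 ^ 2))) *
        cos (√s * (v 0 * ξ 0 + v 1 * ξ 1)) := fun f hf s => by
    obtain ⟨C, hC⟩ := hf.exists_bound
    exact ((integrable_exp_neg_normSq hε).const_mul C).mono'
      ((hf.measurable.mul hexp).mul (hcos s)).aestronglyMeasurable
      (Eventually.of_forall fun v => hbd f C s v (hf.nonneg v) (hC v))
  induction hf with
  | gauss a b c h =>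
    obtain ⟨K, Q, hK, hKQ⟩ := exists_integral_gauss_mul_cos (A := a + ε) (b := b) (C := c + ε) hε
      (fun x y => by linarith [h x y]) ξ
    refine (IsLogConvex.const_mul_exp hK Q).congr fun s hs => ?_
    have := hKQ (√s)
    rw [sq_sqrt hs] at this
    rw [← this]
    refine integral_congr_ae (Eventually.of_forall fun v => ?_)
    beta_reduce
    rw [← exp_add]
    congr 2
    ring
  | add f g hf hg ihf ihg =>
    refine (ihf.add ihg).congr fun s _ => ?_
    rw [← integral_add (hInt f hf s) (hInt g hg s)]
    refine integral_congr_ae (Eventually.of_forall fun v => ?_)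
    beta_reduce
    ring
  | smul r hr f hf ih =>
    refine (ih.smul hr).congr fun s _ => ?_
    rw [← integral_const_mul]
    refine integral_congr_ae (Eventually.of_forall fun v => ?_)
    beta_reduce
    ring
  | lim f g C hf hC h ih =>
    refine IsLogConvex.lim _ ih fun s _ => ?_
    refine tendsto_integral_of_dominated_convergence
      (fun v => C * exp (-(ε * (v 0 ^ 2 + v 1 ^ 2)))) (fun k => (hInt _ (hf k) s).1)
      ((integrable_exp_neg_normSq hε).const_mul C)
      (fun k => Eventually.of_forall fun v => hbd _ C s v ((hf k).nonneg v) (hC k v))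
      (Eventually.of_forall fun v => ((h v).mul_const _).mul_const _)

/-- The cosine transform of an integrable Gaussian mixture is log-convex in the square of the
radial variable. -/
lemma isLogConvex (hf : IsGaussMix f) (hfi : Integrable f) (ξ : Fin 2 → ℝ) :
    IsLogConvex fun s => ∫ v : Fin 2 → ℝ, f v * cos (√s * (v 0 * ξ 0 + v 1 * ξ 1)) := by
  refine IsLogConvex.lim _ (fun k : ℕ => hf.isLogConvex_of_exp_mul
    (Nat.one_div_pos_of_nat (α := ℝ) (n := k)) ξ) fun s _ => ?_
  have hm := hf.measurable
  refine tendsto_integral_of_dominated_convergence f (fun k => ?_) hfi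
    (fun k => Eventually.of_forall fun v => ?_) (Eventually.of_forall fun v => ?_)
  · exact Measurable.aestronglyMeasurable (by fun_prop)
  · rw [norm_mul, norm_mul, norm_of_nonneg (hf.nonneg v), norm_of_nonneg (exp_pos _).le, mul_assoc]
    refine mul_le_of_le_one_right (hf.nonneg v) (mul_le_one₀ ?_ (norm_nonneg _) (abs_cos_le_one _))
    exact exp_le_one_iff.2 (neg_nonpos.2 (by positivity))
  · refine Tendsto.mul_const _ ?_
    have h1 : Tendsto (fun k : ℕ => exp (-(1 / ((k : ℝ) + 1) * (v 0 ^ 2 + v 1 ^ 2)))) atTop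
        (𝓝 (exp (-(0 * (v 0 ^ 2 + v 1 ^ 2))))) :=
      (continuous_exp.tendsto _).comp
        ((tendsto_one_div_add_atTop_nhds_zero_nat.mul_const _).neg)
    simpa using h1.const_mul (f v)

end IsGaussMix

section LayerCake

variable {ι : Type*} [Fintype ι] {Ψ : (ι → ℝ) → ℝ} {p : ℝ}

open scoped Pointwise in
lemma volume_homogeneous_le (hp : 0 < p) (hhom : ∀ c : ℝ, 0 < c → ∀ y, Ψ (c • y) = c ^ p * Ψ y)
    {s : ℝ} (hs : 0 < s) :
    volume {y | Ψ y ≤ s} = ENNReal.ofReal (s ^ (Fintype.card ι / p)) * volume {y | Ψ y ≤ 1} := by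
  have hc : 0 < s ^ (1 / p) := rpow_pos_of_pos hs _
  have h : {y | Ψ y ≤ s} = s ^ (1 / p) • {y | Ψ y ≤ 1} := by
    ext y
    rw [Set.mem_smul_set_iff_inv_smul_mem₀ hc.ne', Set.mem_ofPred_eq, Set.mem_ofPred_eq,
      hhom _ (inv_pos.2 hc), inv_rpow hc.le, ← rpow_mul hs.le, one_div_mul_cancel hp.ne', rpow_one,
      inv_mul_le_one₀ hs]
  rw [h, Measure.addHaar_smul, Module.finrank_fintype_fun_eq_card, abs_of_pos (pow_pos hc _),
    ← rpow_natCast, ← rpow_mul hs.le, one_div_mul_eq_div]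

/-- For a nonnegative homogeneous `Ψ`, the integral of `exp (-Ψ)` is a universal multiple of the
volume of the sublevel set of `Ψ`. -/
lemma lintegral_exp_neg_homogeneous (hm : Measurable Ψ) (h0 : ∀ y, 0 ≤ Ψ y) (hp : 0 < p)
    (hhom : ∀ c : ℝ, 0 < c → ∀ y, Ψ (c • y) = c ^ p * Ψ y) :
    ∫⁻ y, ENNReal.ofReal (exp (-Ψ y)) =
      ENNReal.ofReal (Gamma (Fintype.card ι / p + 1)) * volume {y | Ψ y ≤ 1} := by
  have hA : MeasurableSet {z : (ι → ℝ) × ℝ | Ψ z.1 ≤ z.2} :=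
    measurableSet_le (hm.comp measurable_fst) measurable_snd
  have h1 : ∀ y, ENNReal.ofReal (exp (-Ψ y)) = ∫⁻ s in Set.Ioi (0 : ℝ),
      {z : (ι → ℝ) × ℝ | Ψ z.1 ≤ z.2}.indicator (fun z => ENNReal.ofReal (exp (-z.2))) (y, s) := by
    intro y
    have h2 : ∀ s, {z : (ι → ℝ) × ℝ | Ψ z.1 ≤ z.2}.indicator
        (fun z => ENNReal.ofReal (exp (-z.2))) (y, s) =
        (Set.Ici (Ψ y)).indicator (fun s => ENNReal.ofReal (exp (-s))) s := fun s => rfl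
    simp only [h2]
    rw [lintegral_indicator measurableSet_Ici, Measure.restrict_restrict measurableSet_Ici,
      ← integral_exp_neg_Ioi, ofReal_integral_eq_lintegral_ofReal (integrableOn_exp_neg_Ioi _)
        (Eventually.of_forall fun s => (exp_pos _).le)]
    refine setLIntegral_congr ?_
    have h3 : Set.Ioi (Ψ y) ∩ Set.Ioi 0 = Set.Ioi (Ψ y) :=
      Set.inter_eq_left.2 (Set.Ioi_subset_Ioi (h0 y))
    rw [← h3]
    exact Ioi_ae_eq_Ici.inter (ae_eq_refl _)
  simp only [h1]
  rw [lintegral_lintegral_swap]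
  · have h2 : ∀ s ∈ Set.Ioi (0 : ℝ), ∫⁻ y, {z : (ι → ℝ) × ℝ | Ψ z.1 ≤ z.2}.indicator
        (fun z => ENNReal.ofReal (exp (-z.2))) (y, s) =
        ENNReal.ofReal (exp (-s) * s ^ (Fintype.card ι / p + 1 - 1)) * volume {y | Ψ y ≤ 1} := by
      intro s hs
      have h3 : ∀ y, {z : (ι → ℝ) × ℝ | Ψ z.1 ≤ z.2}.indicator
          (fun z => ENNReal.ofReal (exp (-z.2))) (y, s) =
          {y | Ψ y ≤ s}.indicator (fun _ => ENNReal.ofReal (exp (-s))) y := fun y => rfl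
      simp only [h3]
      rw [lintegral_indicator_const (measurableSet_le hm measurable_const),
        volume_homogeneous_le hp hhom hs, ← mul_assoc, ← ENNReal.ofReal_mul (exp_pos _).le,
        add_sub_cancel_right]
    have hpos : 0 < (Fintype.card ι / p + 1 : ℝ) := by positivity
    rw [setLIntegral_congr_fun measurableSet_Ioi h2, lintegral_mul_const, Gamma_eq_integral hpos,
      ofReal_integral_eq_lintegral_ofReal (GammaIntegral_convergent hpos)]
    · exact (ae_restrict_mem measurableSet_Ioi).mono fun s hs =>
        mul_nonneg (exp_pos _).le (rpow_nonneg (le_of_lt hs) _)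
    · fun_prop
  · refine AEMeasurable.indicator ?_ hA
    fun_prop

lemma integrable_exp_neg_homogeneous (hm : Measurable Ψ) (h0 : ∀ y, 0 ≤ Ψ y) (hp : 0 < p)
    (hhom : ∀ c : ℝ, 0 < c → ∀ y, Ψ (c • y) = c ^ p * Ψ y)
    (hb : Bornology.IsBounded {y | Ψ y ≤ 1}) : Integrable fun y => exp (-Ψ y) := by
  refine ⟨by fun_prop, ?_⟩
  rw [hasFiniteIntegral_iff_ofReal (Eventually.of_forall fun y => (exp_pos _).le),
    lintegral_exp_neg_homogeneous hm h0 hp hhom]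
  exact ENNReal.mul_lt_top ENNReal.ofReal_lt_top hb.measure_lt_top

/-- Comparison of volumes of sublevel sets through the integrals of `exp (-Ψ)`. -/
lemma volume_le_of_integral_exp_neg_le {κ : Type*} [Fintype κ] {Φ : (κ → ℝ) → ℝ} (hp : 0 < p)
    (hcard : Fintype.card ι = Fintype.card κ)
    (hm : Measurable Ψ) (h0 : ∀ y, 0 ≤ Ψ y)
    (hhom : ∀ c : ℝ, 0 < c → ∀ y, Ψ (c • y) = c ^ p * Ψ y)
    (hi : Integrable fun y => exp (-Ψ y))
    (hm' : Measurable Φ) (h0' : ∀ y, 0 ≤ Φ y)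
    (hhom' : ∀ c : ℝ, 0 < c → ∀ y, Φ (c • y) = c ^ p * Φ y)
    (hi' : Integrable fun y => exp (-Φ y))
    (h : ∫ y, exp (-Ψ y) ≤ ∫ y, exp (-Φ y)) :
    volume {y | Ψ y ≤ 1} ≤ volume {y | Φ y ≤ 1} := by
  have h1 := ENNReal.ofReal_le_ofReal h
  rw [ofReal_integral_eq_lintegral_ofReal hi (Eventually.of_forall fun y => (exp_pos _).le),
    ofReal_integral_eq_lintegral_ofReal hi' (Eventually.of_forall fun y => (exp_pos _).le),
    lintegral_exp_neg_homogeneous hm h0 hp hhom, lintegral_exp_neg_homogeneous hm' h0' hp hhom',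
    hcard] at h1
  refine (ENNReal.mul_le_mul_iff_right ?_ ENNReal.ofReal_ne_top).1 h1
  exact (ENNReal.ofReal_pos.2 (Gamma_pos_of_pos (by positivity))).ne'

end LayerCake

lemma measurePreserving_curry (α β : Type*) [Fintype α] [Fintype β] :
    MeasurePreserving (MeasurableEquiv.curry α β ℝ) volume volume := by
  refine MeasurePreserving.symm (MeasurableEquiv.curry α β ℝ).symm
    ⟨(MeasurableEquiv.curry α β ℝ).symm.measurable, ?_⟩
  refine (Measure.pi_eq fun s hs => ?_).symm
  rw [MeasurableEquiv.map_apply]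
  have h : (MeasurableEquiv.curry α β ℝ).symm ⁻¹' Set.univ.pi s =
      Set.univ.pi fun i => Set.univ.pi fun j => s (i, j) := by
    ext x
    simp only [Set.mem_preimage, Set.mem_univ_pi, Prod.forall]
    rfl
  rw [h, volume_pi_pi]
  simp only [volume_pi_pi]
  rw [Fintype.prod_prod_type]

lemma measurePreserving_of_sum_sq {α β : Type*} [Fintype α] [Fintype β]
    (hcard : Fintype.card α = Fintype.card β) (L : (α → ℝ) →ₗ[ℝ] (β → ℝ))
    (hL : ∀ x, ∑ b, L x b ^ 2 = ∑ a, x a ^ 2) : MeasurePreserving L volume volume := by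
  let L' : EuclideanSpace ℝ α →ₗᵢ[ℝ] EuclideanSpace ℝ β :=
    { toLinearMap := (WithLp.linearEquiv 2 ℝ (β → ℝ)).symm.toLinearMap ∘ₗ L ∘ₗ
        (WithLp.linearEquiv 2 ℝ (α → ℝ)).toLinearMap
      norm_map' := fun x => by
        rw [EuclideanSpace.norm_eq, EuclideanSpace.norm_eq]
        simp only [norm_eq_abs, sq_abs]
        exact congrArg _ (hL x.ofLp) }
  have h := (L'.toLinearIsometryEquiv (by simpa using hcard)).measurePreserving
  exact ((PiLp.volume_preserving_ofLp β).comp h).comp (PiLp.volume_preserving_toLp α)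

/-- The cosine transform of `f`; for even `f` this is the Fourier transform. -/
def cosTransform (f : (Fin 2 → ℝ) → ℝ) (ξ : Fin 2 → ℝ) : ℝ :=
  ∫ v : Fin 2 → ℝ, f v * cos (v 0 * ξ 0 + v 1 * ξ 1)

section CosTransform

variable {f : (Fin 2 → ℝ) → ℝ} {n : ℕ}

lemma cosTransform_zero : cosTransform f 0 = ∫ v, f v := by
  simp [cosTransform]

lemma cosTransform_smul (t : ℝ) (ξ : Fin 2 → ℝ) :
    cosTransform f (t • ξ) = ∫ v : Fin 2 → ℝ, f v * cos (√(t ^ 2) * (v 0 * ξ 0 + v 1 * ξ 1)) := by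
  refine integral_congr_ae (Eventually.of_forall fun v => ?_)
  simp only [Pi.smul_apply, smul_eq_mul]
  rw [show v 0 * (t * ξ 0) + v 1 * (t * ξ 1) = t * (v 0 * ξ 0 + v 1 * ξ 1) by ring, sqrt_sq_eq_abs,
    ← cos_abs, ← cos_abs (|t| * _), abs_mul, abs_mul, abs_abs]

namespace IsGaussMix

lemma prod_cosTransform_le (hf : IsGaussMix f) (hfi : Integrable f) {θ : Fin n → ℝ}
    (hθ : ∑ i, θ i ^ 2 = 1) (ξ : Fin 2 → ℝ) :
    ∏ i, cosTransform f (θ i • ξ) ≤ cosTransform f 0 ^ (n - 1) * cosTransform f ξ := by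
  have h := (hf.isLogConvex hfi ξ).prod_le (fun i => θ i ^ 2) (fun i => sq_nonneg _) hθ
  simp only [← cosTransform_smul] at h
  simpa [cosTransform] using h

lemma cosTransform_pow_le (hf : IsGaussMix f) (hfi : Integrable f) {θ : Fin n → ℝ}
    (hθ : ∑ i, θ i ^ 2 = 1) (ξ : Fin 2 → ℝ) :
    ∏ _i : Fin n, cosTransform f ((√n)⁻¹ • ξ) ≤ ∏ i, cosTransform f (θ i • ξ) := by
  have h := (hf.isLogConvex hfi ξ).pow_le_prod (fun i => θ i ^ 2) (fun i => sq_nonneg _) hθ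
  have hn : (1 / n : ℝ) = (√n)⁻¹ ^ 2 := by
    rw [inv_pow, sq_sqrt n.cast_nonneg, one_div]
  simp only [hn, ← cosTransform_smul] at h
  simpa using h

end IsGaussMix

lemma integrable_mul_cos (hfi : Integrable f) (ξ : Fin 2 → ℝ) :
    Integrable fun v : Fin 2 → ℝ => f v * cos (v 0 * ξ 0 + v 1 * ξ 1) := by
  refine hfi.norm.mono' (hfi.1.mul (by fun_prop)) (Eventually.of_forall fun v => ?_)
  rw [norm_mul]
  exact mul_le_of_le_one_right (norm_nonneg _) (abs_cos_le_one _)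

lemma integrable_mul_sin (hfi : Integrable f) (ξ : Fin 2 → ℝ) :
    Integrable fun v : Fin 2 → ℝ => f v * sin (v 0 * ξ 0 + v 1 * ξ 1) := by
  refine hfi.norm.mono' (hfi.1.mul (by fun_prop)) (Eventually.of_forall fun v => ?_)
  rw [norm_mul]
  exact mul_le_of_le_one_right (norm_nonneg _) (abs_sin_le_one _)

lemma integral_mul_cexp_eq_cosTransform (hfi : Integrable f) (heven : ∀ v, f (-v) = f v)
    (ξ : Fin 2 → ℝ) :
    ∫ v : Fin 2 → ℝ, (f v : ℂ) * Complex.exp ((v 0 * ξ 0 + v 1 * ξ 1 : ℝ) * Complex.I) =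
      cosTransform f ξ := by
  have h1 : ∀ v : Fin 2 → ℝ,
      (f v : ℂ) * Complex.exp ((v 0 * ξ 0 + v 1 * ξ 1 : ℝ) * Complex.I) =
        ((f v * cos (v 0 * ξ 0 + v 1 * ξ 1) : ℝ) : ℂ) +
          ((f v * sin (v 0 * ξ 0 + v 1 * ξ 1) : ℝ) : ℂ) * Complex.I := fun v => by
    rw [Complex.exp_mul_I, ← Complex.ofReal_cos, ← Complex.ofReal_sin, Complex.ofReal_mul,
      Complex.ofReal_mul]
    ring
  have h2 : ∫ v : Fin 2 → ℝ, f v * sin (v 0 * ξ 0 + v 1 * ξ 1) = 0 := by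
    have h3 := integral_neg_eq_self (μ := volume)
      fun v : Fin 2 → ℝ => f v * sin (v 0 * ξ 0 + v 1 * ξ 1)
    have h4 : ∀ v : Fin 2 → ℝ, f (-v) * sin ((-v) 0 * ξ 0 + (-v) 1 * ξ 1) =
        -(f v * sin (v 0 * ξ 0 + v 1 * ξ 1)) := fun v => by
      rw [heven, Pi.neg_apply, Pi.neg_apply, ← mul_neg, ← sin_neg]
      congr 2
      ring
    simp only [h4, integral_neg] at h3
    linarith
  simp only [h1]
  have hc : Integrable fun v : Fin 2 → ℝ => ((f v * cos (v 0 * ξ 0 + v 1 * ξ 1) : ℝ) : ℂ) :=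
    (integrable_mul_cos hfi ξ).ofReal
  have hs : Integrable fun v : Fin 2 → ℝ => ((f v * sin (v 0 * ξ 0 + v 1 * ξ 1) : ℝ) : ℂ) :=
    (integrable_mul_sin hfi ξ).ofReal
  rw [integral_add hc (hs.mul_const Complex.I),
    integral_mul_const, integral_complex_ofReal, integral_complex_ofReal, h2, cosTransform]
  simp

lemma integral_prod_blocks {𝕜 : Type*} [RCLike 𝕜] (F : Fin n → (Fin 2 → ℝ) → 𝕜) :
    ∫ x : Fin n × Fin 2 → ℝ, ∏ i, F i (fun j => x (i, j)) = ∏ i, ∫ v, F i v := by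
  rw [← integral_fintype_prod_volume_eq_prod,
    ← (measurePreserving_curry (Fin n) (Fin 2)).integral_comp']
  rfl

lemma integrable_prod_blocks (hfi : Integrable f) :
    Integrable fun x : Fin n × Fin 2 → ℝ => ∏ i, f (fun j => x (i, j)) :=
  ((measurePreserving_curry (Fin n) (Fin 2)).integrable_comp_emb
    (MeasurableEquiv.measurableEmbedding _)).2
    (Integrable.fintype_prod (μ := fun _ => volume) (f := fun _ : Fin n => f) fun _ => hfi)

lemma integral_gauss_mul_cexp {τ : ℝ} (hτ : 0 < τ) (a : Fin 2 → ℝ) :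
    ∫ ξ : Fin 2 → ℝ, Complex.exp (-∑ j, ((τ ^ 2 : ℝ) : ℂ) * (ξ j : ℂ) ^ 2 +
      ∑ j, (Complex.I * a j) * ξ j) =
      ((π / τ ^ 2 * exp (-((a 0 ^ 2 + a 1 ^ 2) / (4 * τ ^ 2))) : ℝ) : ℂ) := by
  rw [GaussianFourier.integral_cexp_neg_sum_mul_add (b := fun _ : Fin 2 => ((τ ^ 2 : ℝ) : ℂ))
    (fun i => by rw [Complex.ofReal_re]; positivity)]
  have h : ((π : ℂ) / ((τ ^ 2 : ℝ) : ℂ)) ^ (1 / 2 : ℂ) * ((π : ℂ) / ((τ ^ 2 : ℝ) : ℂ)) ^ (1 / 2 : ℂ)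
      = (π : ℂ) / ((τ ^ 2 : ℝ) : ℂ) := by
    have := Complex.cpow_nat_inv_pow ((π : ℂ) / ((τ ^ 2 : ℝ) : ℂ)) two_ne_zero
    rw [← sq, one_div]
    exact_mod_cast this
  rw [Fin.prod_univ_two, mul_mul_mul_comm, h, ← Complex.exp_add]
  push_cast
  congr 2
  rw [mul_pow, mul_pow, Complex.I_sq]
  ring

/-- The cosine transforms of the blocks integrate against a Gaussian to the mass of the product
near the block hyperplane. -/
lemma integral_prod_mul_gauss_eq (hfi : Integrable f) (heven : ∀ v, f (-v) = f v)
    (θ : Fin n → ℝ) {τ : ℝ} (hτ : 0 < τ) :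
    ∫ x : Fin n × Fin 2 → ℝ, (∏ i, f (fun j => x (i, j))) * (π / τ ^ 2 *
      exp (-(((∑ i, θ i * x (i, 0)) ^ 2 + (∑ i, θ i * x (i, 1)) ^ 2) / (4 * τ ^ 2)))) =
    ∫ ξ : Fin 2 → ℝ, exp (-(τ ^ 2 * (ξ 0 ^ 2 + ξ 1 ^ 2))) * ∏ i, cosTransform f (θ i • ξ) := by
  set H : (Fin n × Fin 2 → ℝ) → (Fin 2 → ℝ) → ℂ := fun x ξ =>
    ((∏ i, f (fun j => x (i, j)) : ℝ) : ℂ) *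
      Complex.exp (-∑ j, ((τ ^ 2 : ℝ) : ℂ) * (ξ j : ℂ) ^ 2 +
        ∑ j, (Complex.I * (∑ i, θ i * x (i, j) : ℝ)) * ξ j) with hH
  have hexp : ∀ (a ξ : Fin 2 → ℝ), -∑ j, ((τ ^ 2 : ℝ) : ℂ) * (ξ j : ℂ) ^ 2 +
        ∑ j, (Complex.I * (a j : ℝ)) * ξ j = ((-(τ ^ 2 * (ξ 0 ^ 2 + ξ 1 ^ 2)) : ℝ) : ℂ) +
          ((a 0 * ξ 0 + a 1 * ξ 1 : ℝ) : ℂ) * Complex.I := fun a ξ => by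
    simp only [Fin.sum_univ_two]
    push_cast
    ring
  have hHn : ∀ x ξ, ‖H x ξ‖ = ‖∏ i, f (fun j => x (i, j))‖ *
      exp (-(τ ^ 2 * (ξ 0 ^ 2 + ξ 1 ^ 2))) := fun x ξ => by
    simp only [hH]
    rw [norm_mul, Complex.norm_real, Complex.norm_exp, hexp fun j => ∑ i, θ i * x (i, j)]
    simp only [Complex.add_re, Complex.re_ofReal_mul, Complex.I_re, Complex.ofReal_re, mul_zero,
      add_zero]
  have hFi : Integrable fun x : Fin n × Fin 2 → ℝ => ∏ i, f (fun j => x (i, j)) :=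
    integrable_prod_blocks hfi
  have hHi : Integrable (Function.uncurry H)
      ((volume : Measure (Fin n × Fin 2 → ℝ)).prod (volume : Measure (Fin 2 → ℝ))) := by
    refine (hFi.norm.mul_prod (integrable_exp_neg_normSq (sq_pos_of_pos hτ))).mono' ?_
      (Eventually.of_forall fun z => (hHn z.1 z.2).le)
    refine AEStronglyMeasurable.mul ?_ (Continuous.aestronglyMeasurable (by fun_prop))
    exact (Complex.continuous_ofReal.comp_aestronglyMeasurable hFi.1).comp_fst
  have hswap := integral_integral_swap hHi
  have hleft : ∀ x, ∫ ξ, H x ξ = (((∏ i, f (fun j => x (i, j))) * (π / τ ^ 2 *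
      exp (-(((∑ i, θ i * x (i, 0)) ^ 2 + (∑ i, θ i * x (i, 1)) ^ 2) / (4 * τ ^ 2)))) : ℝ) : ℂ) :=
    fun x => by
      simp only [hH]
      rw [integral_const_mul, integral_gauss_mul_cexp hτ fun j => ∑ i, θ i * x (i, j),
        ← Complex.ofReal_mul]
  have hright : ∀ ξ, ∫ x, H x ξ = ((exp (-(τ ^ 2 * (ξ 0 ^ 2 + ξ 1 ^ 2))) *
      ∏ i, cosTransform f (θ i • ξ) : ℝ) : ℂ) := fun ξ => by
    have h1 : ∀ x, H x ξ = ((exp (-(τ ^ 2 * (ξ 0 ^ 2 + ξ 1 ^ 2))) : ℝ) : ℂ) *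
        ∏ i, ((f (fun j => x (i, j)) : ℂ) *
          Complex.exp ((x (i, 0) * (θ i • ξ) 0 + x (i, 1) * (θ i • ξ) 1 : ℝ) * Complex.I)) := by
      intro x
      simp only [hH]
      rw [hexp fun j => ∑ i, θ i * x (i, j), Complex.exp_add, Finset.prod_mul_distrib,
        ← Complex.exp_sum, ← Finset.sum_mul, Complex.ofReal_prod, Complex.ofReal_exp,
        mul_left_comm]
      congr 4
      rw [← Complex.ofReal_sum]
      congr 1
      simp only [Pi.smul_apply, smul_eq_mul, Finset.sum_mul, ← Finset.sum_add_distrib]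
      exact Finset.sum_congr rfl fun i _ => by ring
    simp only [h1]
    rw [integral_const_mul, integral_prod_blocks fun i v => (f v : ℂ) *
      Complex.exp ((v 0 * (θ i • ξ) 0 + v 1 * (θ i • ξ) 1 : ℝ) * Complex.I)]
    simp only [integral_mul_cexp_eq_cosTransform hfi heven]
    rw [Complex.ofReal_mul, Complex.ofReal_prod]
  simp only [hleft, hright, integral_complex_ofReal] at hswap
  exact_mod_cast hswap

end CosTransform

namespace IsNormOn

variable {N : (Fin 2 → ℝ) → ℝ}

lemma exists_le_mul (hN : IsNormOn 2 N) : ∃ C, 0 ≤ C ∧ ∀ v, N v ≤ C * (|v 0| + |v 1|) := by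
  refine ⟨N ![1, 0] + N ![0, 1], add_nonneg (hN.nonneg _) (hN.nonneg _), fun v => ?_⟩
  have h : v = v 0 • ![1, 0] + v 1 • ![0, 1] := by
    ext i
    fin_cases i <;> simp
  have h1 := hN.2.2 (v 0 • ![1, 0]) (v 1 • ![0, 1])
  rw [← h, hN.2.1, hN.2.1] at h1
  nlinarith [hN.nonneg ![1, 0], hN.nonneg ![0, 1], abs_nonneg (v 0), abs_nonneg (v 1)]

protected lemma continuous (hN : IsNormOn 2 N) : Continuous N := by
  obtain ⟨C, _, hC⟩ := hN.exists_le_mul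
  refine continuous_iff_continuousAt.2 fun x => tendsto_iff_norm_sub_tendsto_zero.2 ?_
  refine squeeze_zero (g := fun y => C * (|(y - x) 0| + |(y - x) 1|)) (fun _ => norm_nonneg _)
    (fun y => ?_) ?_
  · rw [norm_eq_abs, abs_le]
    have h1 := hN.sub_le x y
    rw [← hN.neg (x - y), neg_sub] at h1
    constructor <;> linarith [hN.sub_le y x, hC (y - x)]
  · have h : Continuous fun y : Fin 2 → ℝ => C * (|(y - x) 0| + |(y - x) 1|) := by fun_prop
    simpa using h.tendsto x

lemma exists_mul_norm_le (hN : IsNormOn 2 N) : ∃ c, 0 < c ∧ ∀ v, c * ‖v‖ ≤ N v := by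
  obtain ⟨u, hu, hmin⟩ := (isCompact_sphere (0 : Fin 2 → ℝ) 1).exists_isMinOn
    (NormedSpace.sphere_nonempty.2 zero_le_one) hN.continuous.continuousOn
  have hu1 : ‖u‖ = 1 := by simpa using hu
  have hu0 : u ≠ 0 := fun h => by simp [h] at hu1
  refine ⟨N u, lt_of_le_of_ne (hN.nonneg u) fun h => hu0 ((hN.1 u).1 h.symm), fun v => ?_⟩
  by_cases hv : v = 0
  · simp [hv, (hN.1 0).2 rfl]
  have hv' : 0 < ‖v‖ := norm_pos_iff.2 hv
  have h1 : N u ≤ N (‖v‖⁻¹ • v) := hmin (by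
    rw [mem_sphere_zero_iff_norm, norm_smul, norm_inv, norm_norm, inv_mul_cancel₀ hv'.ne'])
  rwa [hN.smul_of_nonneg (inv_nonneg.2 hv'.le), le_inv_mul_iff₀ hv', mul_comm] at h1

end IsNormOn

/-- The `p`-th power of the `ℓ_p` sum of the block norms. -/
def lpSum (n : ℕ) (p : ℝ) (N : (Fin 2 → ℝ) → ℝ) (x : Fin n × Fin 2 → ℝ) : ℝ :=
  ∑ i : Fin n, N (fun j => x (i, j)) ^ p

section LpSum

variable {N : (Fin 2 → ℝ) → ℝ} {p : ℝ} {n : ℕ}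

lemma lpSum_nonneg (hN : IsNormOn 2 N) (x : Fin n × Fin 2 → ℝ) : 0 ≤ lpSum n p N x :=
  Finset.sum_nonneg fun _ _ => rpow_nonneg (hN.nonneg _) _

lemma continuous_lpSum (hN : IsNormOn 2 N) (hp : 0 < p) : Continuous (lpSum n p N) :=
  continuous_finsetSum _ fun i _ => Continuous.rpow_const
    (hN.continuous.comp (by fun_prop : Continuous fun (x : Fin n × Fin 2 → ℝ) j => x (i, j)))
    fun _ => Or.inr hp.le

lemma lpSum_smul (hN : IsNormOn 2 N) {c : ℝ} (hc : 0 < c) (x : Fin n × Fin 2 → ℝ) :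
    lpSum n p N (c • x) = c ^ p * lpSum n p N x := by
  rw [lpSum, lpSum, Finset.mul_sum]
  refine Finset.sum_congr rfl fun i _ => ?_
  rw [← mul_rpow hc.le (hN.nonneg _), ← hN.smul_of_nonneg hc.le]
  rfl

lemma exp_neg_lpSum (x : Fin n × Fin 2 → ℝ) :
    exp (-lpSum n p N x) = ∏ i, exp (-N (fun j => x (i, j)) ^ p) := by
  rw [← exp_sum, lpSum, Finset.sum_neg_distrib]

lemma isBounded_lpSum_comp_le (hN : IsNormOn 2 N) (hp : 0 < p) {α : Type*} [Fintype α]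
    (ι : (α → ℝ) →ₗ[ℝ] (Fin n × Fin 2 → ℝ)) (hι : ∀ y, ∑ c, ι y c ^ 2 = ∑ i, y i ^ 2) :
    Bornology.IsBounded {y | lpSum n p N (ι y) ≤ 1} := by
  obtain ⟨c, hc, hcN⟩ := hN.exists_mul_norm_le
  refine isBounded_iff_forall_norm_le.2 ⟨√(∑ _k : Fin n × Fin 2, (c⁻¹) ^ 2), fun y hy => ?_⟩
  refine (pi_norm_le_iff_of_nonneg (sqrt_nonneg _)).2 fun a => ?_
  rw [norm_eq_abs]
  refine abs_le_sqrt ((Finset.single_le_sum (f := fun a => y a ^ 2) (fun _ _ => sq_nonneg _)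
    (Finset.mem_univ a)).trans ?_)
  rw [← hι]
  refine Finset.sum_le_sum fun k _ => sq_le_sq' ?_ ?_ <;>
  · have h1 : N (fun j => ι y (k.1, j)) ^ p ≤ 1 :=
      (Finset.single_le_sum (f := fun i => N (fun j => ι y (i, j)) ^ p)
        (fun _ _ => rpow_nonneg (hN.nonneg _) _) (Finset.mem_univ k.1)).trans hy
    have h2 : N (fun j => ι y (k.1, j)) ≤ 1 := by
      by_contra! h
      exact absurd h1 (not_le.2 (one_lt_rpow h hp))
    have h3 : |ι y k| ≤ ‖fun j => ι y (k.1, j)‖ := norm_le_pi_norm (fun j => ι y (k.1, j)) k.2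
    have h4 : |ι y k| ≤ c⁻¹ := by
      rw [← one_div, le_div_iff₀' hc]
      exact (mul_le_mul_of_nonneg_left h3 hc.le).trans ((hcN _).trans h2)
    linarith [neg_le_of_abs_le h4, le_of_abs_le h4]

lemma integrable_exp_neg_lpSum_comp (hN : IsNormOn 2 N) (hp : 0 < p) {α : Type*} [Fintype α]
    (ι : (α → ℝ) →ₗ[ℝ] (Fin n × Fin 2 → ℝ)) (hι : ∀ y, ∑ c, ι y c ^ 2 = ∑ i, y i ^ 2) :
    Integrable fun y => exp (-lpSum n p N (ι y)) :=
  integrable_exp_neg_homogeneous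
    ((continuous_lpSum hN hp).comp ι.continuous_of_finiteDimensional).measurable
    (fun _ => lpSum_nonneg hN _) hp (fun c hc y => by rw [map_smul, lpSum_smul hN hc])
    (isBounded_lpSum_comp_le hN hp ι hι)

lemma integrable_exp_neg_rpow (hN : IsNormOn 2 N) (hp : 0 < p) :
    Integrable fun v => exp (-N v ^ p) := by
  obtain ⟨c, hc, hcN⟩ := hN.exists_mul_norm_le
  refine integrable_exp_neg_homogeneous (p := p)
    (hN.continuous.rpow_const fun _ => Or.inr hp.le).measurable
    (fun _ => rpow_nonneg (hN.nonneg _) _) hp (fun c hc y => ?_) ?_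
  · rw [hN.smul_of_nonneg hc.le, mul_rpow hc.le (hN.nonneg _)]
  · refine isBounded_iff_forall_norm_le.2 ⟨c⁻¹, fun v hv => ?_⟩
    have h2 : N v ≤ 1 := by
      by_contra! h
      exact absurd hv (not_le.2 (one_lt_rpow h hp))
    rw [← one_div, le_div_iff₀' hc]
    exact (hcN v).trans h2

end LpSum

lemma integral_exp_neg_normSq {ε : ℝ} (hε : 0 < ε) :
    ∫ v : Fin 2 → ℝ, exp (-(ε * (v 0 ^ 2 + v 1 ^ 2))) = π / ε := by
  have h := integral_fintype_prod_volume_eq_prod (fun (_ : Fin 2) (t : ℝ) => exp (-ε * t ^ 2))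
  simp only [Fin.prod_univ_two, integral_gaussian, ← exp_add] at h
  rw [mul_self_sqrt (by positivity)] at h
  rw [← h]
  refine integral_congr_ae (Eventually.of_forall fun v => ?_)
  beta_reduce
  congr 1
  ring

section Slice

variable {n d : ℕ}

/-- Decomposition of block vectors along a block hyperplane and its orthogonal complement. -/
def sliceMap (θ : Fin n → ℝ) (ι : (Fin d → ℝ) →ₗ[ℝ] (Fin n × Fin 2 → ℝ)) :
    (Fin d ⊕ Fin 2 → ℝ) →ₗ[ℝ] (Fin n × Fin 2 → ℝ) where
  toFun u c := ι (fun k => u (Sum.inl k)) c + θ c.1 * u (Sum.inr c.2)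
  map_add' u v := by
    ext c
    have h : (fun k => (u + v) (Sum.inl k)) =
      (fun k => u (Sum.inl k : Fin d ⊕ Fin 2)) + fun k => v (Sum.inl k) := rfl
    rw [h, map_add]
    simp only [Pi.add_apply]
    ring
  map_smul' a u := by
    ext c
    have h : (fun k => (a • u) (Sum.inl k)) =
      a • fun k => u (Sum.inl k : Fin d ⊕ Fin 2) := rfl
    rw [h, map_smul]
    simp only [Pi.smul_apply, smul_eq_mul, RingHom.id_apply]
    ring

variable {θ : Fin n → ℝ} {ι : (Fin d → ℝ) →ₗ[ℝ] (Fin n × Fin 2 → ℝ)}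

lemma sum_sliceMap_sq (hθ : ∑ i, θ i ^ 2 = 1) (hι : ∀ y, ∑ c, ι y c ^ 2 = ∑ i, y i ^ 2)
    (horth : ∀ y j, ∑ i, θ i * ι y (i, j) = 0) (u : Fin d ⊕ Fin 2 → ℝ) :
    ∑ c, sliceMap θ ι u c ^ 2 = ∑ a, u a ^ 2 := by
  set y : Fin d → ℝ := fun k => u (Sum.inl k) with hy
  have h : ∀ c, sliceMap θ ι u c ^ 2 = ι y c ^ 2 + (2 * u (Sum.inr c.2) * (θ c.1 * ι y c) +
      u (Sum.inr c.2) ^ 2 * θ c.1 ^ 2) := by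
    intro c
    simp only [sliceMap, LinearMap.coe_mk, AddHom.coe_mk, ← hy]
    ring
  simp only [h, Finset.sum_add_distrib, hι, Fintype.sum_sum_type]
  rw [Fintype.sum_prod_type_right, Fintype.sum_prod_type_right]
  simp only [← Finset.mul_sum, horth, hθ]
  simp [hy]

lemma measurePreserving_sliceMap (hd : d + 2 = n * 2) (hθ : ∑ i, θ i ^ 2 = 1)
    (hι : ∀ y, ∑ c, ι y c ^ 2 = ∑ i, y i ^ 2) (horth : ∀ y j, ∑ i, θ i * ι y (i, j) = 0) :
    MeasurePreserving (fun z : (Fin d → ℝ) × (Fin 2 → ℝ) => ι z.1 + fun c => θ c.1 * z.2 c.2)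
      volume volume :=
  (measurePreserving_of_sum_sq (by simpa using hd) (sliceMap θ ι)
    (sum_sliceMap_sq hθ hι horth)).comp
    (volume_measurePreserving_sumPiEquivProdPi fun _ : Fin d ⊕ Fin 2 => ℝ).symm

variable {N : (Fin 2 → ℝ) → ℝ} {p : ℝ}

/-- The Gaussian mollification of the section integral of `exp (-lpSum)`. -/
def mollifiedSection (n : ℕ) (p : ℝ) (N : (Fin 2 → ℝ) → ℝ) (θ : Fin n → ℝ) (τ : ℝ) : ℝ :=
  ∫ x : Fin n × Fin 2 → ℝ, (∏ i, exp (-N (fun j => x (i, j)) ^ p)) *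
    (π / τ ^ 2 * exp (-(((∑ i, θ i * x (i, 0)) ^ 2 + (∑ i, θ i * x (i, 1)) ^ 2) / (4 * τ ^ 2))))

lemma integrable_mollified (hN : IsNormOn 2 N) (hp : 0 < p) (θ : Fin n → ℝ) (τ : ℝ) :
    Integrable fun x : Fin n × Fin 2 → ℝ => (∏ i, exp (-N (fun j => x (i, j)) ^ p)) *
      (π / τ ^ 2 *
        exp (-(((∑ i, θ i * x (i, 0)) ^ 2 + (∑ i, θ i * x (i, 1)) ^ 2) / (4 * τ ^ 2)))) := by
  refine (integrable_prod_blocks (integrable_exp_neg_rpow hN hp)).mul_bdd (c := π / τ ^ 2)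
    (by fun_prop) (Eventually.of_forall fun x => ?_)
  rw [norm_eq_abs, abs_of_nonneg (by positivity)]
  exact mul_le_of_le_one_right (by positivity)
    (exp_le_one_iff.2 (neg_nonpos.2 (by positivity)))

/-- A Gaussian-type majorant for translates of `exp (-lpSum)`. -/
lemma exists_exp_neg_lpSum_add_le (hN : IsNormOn 2 N) (hp0 : 0 < p) (hp1 : p ≤ 1)
    (hθ : ∀ i, |θ i| ≤ 1) : ∃ K, ∀ τ, 0 < τ → τ ≤ 1 → ∀ (x : Fin n × Fin 2 → ℝ) (w : Fin 2 → ℝ),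
    exp (-lpSum n p N (x + fun c : Fin n × Fin 2 => θ c.1 * (τ * w c.2))) *
      (π * exp (-(4⁻¹ * (w 0 ^ 2 + w 1 ^ 2)))) ≤
    exp (-lpSum n p N x) * (K * exp (-(8⁻¹ * (w 0 ^ 2 + w 1 ^ 2)))) := by
  obtain ⟨C, hC0, hC⟩ := hN.exists_le_mul
  refine ⟨π * exp (n + 4 * n ^ 2 * C ^ 2), fun τ hτ0 hτ1 x w => ?_⟩
  have key : lpSum n p N x ≤ lpSum n p N (x + fun c : Fin n × Fin 2 => θ c.1 * (τ * w c.2)) +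
      n * (1 + C * (|w 0| + |w 1|)) := by
    have h : ∀ i : Fin n, N (fun j => x (i, j)) ^ p ≤
        N (fun j => (x + fun c : Fin n × Fin 2 => θ c.1 * (τ * w c.2)) (i, j)) ^ p
          + (1 + C * (|w 0| + |w 1|)) := by
      intro i
      set a : Fin 2 → ℝ :=
        fun j => (x + fun c : Fin n × Fin 2 => θ c.1 * (τ * w c.2)) (i, j) with ha
      have h1 : (fun j => x (i, j)) = a + (-(θ i * τ)) • w := by
        ext j
        simp only [ha, Pi.add_apply, Pi.smul_apply, smul_eq_mul]
        ring
      have h2 : N (fun j => x (i, j)) ≤ N a + N w := by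
        rw [h1]
        refine (hN.2.2 _ _).trans (add_le_add_right ?_ _)
        rw [hN.2.1, abs_neg, abs_mul, abs_of_pos hτ0]
        exact mul_le_of_le_one_left (hN.nonneg w) (mul_le_one₀ (hθ i) hτ0.le hτ1)
      have h3 : N w ^ p ≤ 1 + N w := by
        have h4 : N w ^ p ≤ (1 + N w) ^ p :=
          rpow_le_rpow (hN.nonneg w) (by linarith) hp0.le
        refine h4.trans ?_
        have h5 := rpow_le_rpow_of_exponent_le (x := 1 + N w) (by linarith [hN.nonneg w]) hp1
        rwa [rpow_one] at h5
      have h6 := (rpow_le_rpow (hN.nonneg _) h2 hp0.le).trans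
        (rpow_add_le_add_rpow (hN.nonneg a) (hN.nonneg w) hp0.le hp1)
      linarith [hC w]
    have h7 := Finset.sum_le_sum fun i (_ : i ∈ Finset.univ) => h i
    rw [Finset.sum_add_distrib] at h7
    simpa [lpSum, mul_add] using h7
  have hsq : ∀ t : ℝ, n * (C * |t|) ≤ 8⁻¹ * t ^ 2 + 2 * n ^ 2 * C ^ 2 := by
    intro t
    have h := sq_nonneg (|t| - 4 * (n * C))
    have h' := sq_abs t
    nlinarith
  have hE : exp (-lpSum n p N (x + fun c : Fin n × Fin 2 => θ c.1 * (τ * w c.2))) *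
      exp (-(4⁻¹ * (w 0 ^ 2 + w 1 ^ 2))) ≤
      exp (-lpSum n p N x) * (exp (n + 4 * n ^ 2 * C ^ 2) *
        exp (-(8⁻¹ * (w 0 ^ 2 + w 1 ^ 2)))) := by
    rw [← exp_add, ← exp_add, ← exp_add, exp_le_exp]
    linarith [hsq (w 0), hsq (w 1)]
  linarith [mul_le_mul_of_nonneg_left hE pi_pos.le]

lemma continuous_exp_neg_lpSum_slice (hN : IsNormOn 2 N) (hp : 0 < p) (θ : Fin n → ℝ)
    (ι : (Fin d → ℝ) →ₗ[ℝ] (Fin n × Fin 2 → ℝ)) :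
    Continuous fun q : ℝ × (Fin d → ℝ) × (Fin 2 → ℝ) =>
      exp (-lpSum n p N (ι q.2.1 + fun c : Fin n × Fin 2 => θ c.1 * (q.1 * q.2.2 c.2))) *
        (π * exp (-(4⁻¹ * (q.2.2 0 ^ 2 + q.2.2 1 ^ 2)))) := by
  have h1 := continuous_lpSum (n := n) hN hp
  have h2 := ι.continuous_of_finiteDimensional
  fun_prop

lemma integrable_majorant (hN : IsNormOn 2 N) (hp : 0 < p)
    (hι : ∀ y, ∑ c, ι y c ^ 2 = ∑ i, y i ^ 2) (K : ℝ) {ε : ℝ} (hε : 0 < ε) :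
    Integrable fun z : (Fin d → ℝ) × (Fin 2 → ℝ) =>
      exp (-lpSum n p N (ι z.1)) * (K * exp (-(ε * (z.2 0 ^ 2 + z.2 1 ^ 2)))) :=
  (integrable_exp_neg_lpSum_comp hN hp ι hι).mul_prod
    ((integrable_exp_neg_normSq hε).const_mul K)

lemma mollifiedSection_eq (hN : IsNormOn 2 N) (hp0 : 0 < p) (hp1 : p ≤ 1) (hd : d + 2 = n * 2)
    (hθ : ∑ i, θ i ^ 2 = 1) (hι : ∀ y, ∑ c, ι y c ^ 2 = ∑ i, y i ^ 2)
    (horth : ∀ y j, ∑ i, θ i * ι y (i, j) = 0) {τ : ℝ} (hτ0 : 0 < τ) (hτ1 : τ ≤ 1) :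
    mollifiedSection n p N θ τ = ∫ z : (Fin d → ℝ) × (Fin 2 → ℝ),
      exp (-lpSum n p N (ι z.1 + fun c : Fin n × Fin 2 => θ c.1 * (τ * z.2 c.2))) *
        (π * exp (-(4⁻¹ * (z.2 0 ^ 2 + z.2 1 ^ 2)))) := by
  have hM := measurePreserving_sliceMap hd hθ hι horth
  have hG := integrable_mollified hN hp0 θ τ
  have hθ1 : ∀ i, |θ i| ≤ 1 := fun i => by
    rw [← sq_le_one_iff_abs_le_one, ← hθ]
    exact Finset.single_le_sum (f := fun i => θ i ^ 2) (fun _ _ => sq_nonneg _) (Finset.mem_univ i)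
  obtain ⟨K, hK⟩ := exists_exp_neg_lpSum_add_le hN hp0 hp1 hθ1
  have hH : Integrable fun z : (Fin d → ℝ) × (Fin 2 → ℝ) =>
      exp (-lpSum n p N (ι z.1 + fun c : Fin n × Fin 2 => θ c.1 * (τ * z.2 c.2))) *
        (π * exp (-(4⁻¹ * (z.2 0 ^ 2 + z.2 1 ^ 2)))) := by
    refine (integrable_majorant hN hp0 hι K (by norm_num : (0 : ℝ) < 8⁻¹)).mono'
      ((continuous_exp_neg_lpSum_slice hN hp0 θ ι).comp
        (Continuous.prodMk_right τ)).aestronglyMeasurable (Eventually.of_forall fun z => ?_)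
    rw [norm_eq_abs, abs_of_nonneg (by positivity)]
    exact hK τ hτ0 hτ1 _ _
  have hGM := hM.integrable_comp_of_integrable hG
  simp only [Function.comp_def] at hGM
  rw [mollifiedSection, ← hM.map_eq, integral_map hM.measurable.aemeasurable
    (by rw [hM.map_eq]; exact hG.aestronglyMeasurable)]
  rw [Measure.volume_eq_prod, integral_prod _ hGM, integral_prod _ hH]
  refine integral_congr_ae (Eventually.of_forall fun y => ?_)
  beta_reduce
  set g : (Fin 2 → ℝ) → ℝ := fun w => (∏ i, exp (-N (fun j =>
      (ι y + fun c : Fin n × Fin 2 => θ c.1 * w c.2) (i, j)) ^ p)) * (π / τ ^ 2 *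
    exp (-(((∑ i, θ i * (ι y + fun c : Fin n × Fin 2 => θ c.1 * w c.2) (i, 0)) ^ 2 +
      (∑ i, θ i * (ι y + fun c : Fin n × Fin 2 => θ c.1 * w c.2) (i, 1)) ^ 2) / (4 * τ ^ 2))))
  have h1 : ∫ w, g w = τ ^ 2 * ∫ w, g (τ • w) := by
    rw [Measure.integral_comp_smul]
    have : 0 < τ ^ 2 := by positivity
    rw [Module.finrank_fin_fun, abs_of_pos (inv_pos.2 this), smul_eq_mul, ← mul_assoc,
      mul_inv_cancel₀ this.ne', one_mul]
  refine h1.trans ?_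
  rw [← integral_const_mul]
  refine integral_congr_ae (Eventually.of_forall fun w => ?_)
  have h2 : ∀ j, ∑ i, θ i * (ι y + fun c : Fin n × Fin 2 => θ c.1 * (τ • w) c.2) (i, j)
      = τ * w j := by
    intro j
    simp only [Pi.add_apply, mul_add, Finset.sum_add_distrib, horth, zero_add, ← mul_assoc,
      ← sq, ← Finset.sum_mul, hθ, one_mul, Pi.smul_apply, smul_eq_mul]
  simp only [g, h2, ← exp_neg_lpSum]
  have h3 : ((τ * w 0) ^ 2 + (τ * w 1) ^ 2) / (4 * τ ^ 2) = 4⁻¹ * (w 0 ^ 2 + w 1 ^ 2) := by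
    field_simp
  rw [h3]
  simp only [Pi.smul_apply, smul_eq_mul]
  field_simp

lemma tendsto_mollifiedSection (hN : IsNormOn 2 N) (hp0 : 0 < p) (hp1 : p ≤ 1)
    (hd : d + 2 = n * 2) (hθ : ∑ i, θ i ^ 2 = 1) (hι : ∀ y, ∑ c, ι y c ^ 2 = ∑ i, y i ^ 2)
    (horth : ∀ y j, ∑ i, θ i * ι y (i, j) = 0) :
    Tendsto (fun k : ℕ => mollifiedSection n p N θ (1 / ((k : ℝ) + 1))) atTop
      (𝓝 (4 * π ^ 2 * ∫ y, exp (-lpSum n p N (ι y)))) := by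
  have hτ0 : ∀ k : ℕ, 0 < 1 / ((k : ℝ) + 1) := fun k => by positivity
  have hτ1 : ∀ k : ℕ, 1 / ((k : ℝ) + 1) ≤ 1 := fun k =>
    (div_le_one (by positivity)).2 (by linarith [k.cast_nonneg (α := ℝ)])
  have hθ1 : ∀ i, |θ i| ≤ 1 := fun i => by
    rw [← sq_le_one_iff_abs_le_one, ← hθ]
    exact Finset.single_le_sum (f := fun i => θ i ^ 2) (fun _ _ => sq_nonneg _) (Finset.mem_univ i)
  obtain ⟨K, hK⟩ := exists_exp_neg_lpSum_add_le hN hp0 hp1 hθ1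
  have hcont := continuous_exp_neg_lpSum_slice hN hp0 θ ι
  have hlim : 4 * π ^ 2 * ∫ y, exp (-lpSum n p N (ι y)) = ∫ z : (Fin d → ℝ) × (Fin 2 → ℝ),
      exp (-lpSum n p N (ι z.1)) * (π * exp (-(4⁻¹ * (z.2 0 ^ 2 + z.2 1 ^ 2)))) := by
    rw [Measure.volume_eq_prod, integral_prod_mul (fun y => exp (-lpSum n p N (ι y)))
      (fun w : Fin 2 → ℝ => π * exp (-(4⁻¹ * (w 0 ^ 2 + w 1 ^ 2)))), integral_const_mul,
      integral_exp_neg_normSq (by norm_num)]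
    ring
  rw [hlim]
  simp only [fun k => mollifiedSection_eq hN hp0 hp1 hd hθ hι horth (hτ0 k) (hτ1 k)]
  refine tendsto_integral_of_dominated_convergence _
    (fun k => (hcont.comp (Continuous.prodMk_right _)).aestronglyMeasurable)
    (integrable_majorant hN hp0 hι K (by norm_num : (0 : ℝ) < 8⁻¹))
    (fun k => Eventually.of_forall fun z => ?_) (Eventually.of_forall fun z => ?_)
  · rw [norm_eq_abs, abs_of_nonneg (by positivity)]
    exact hK _ (hτ0 k) (hτ1 k) _ _
  · have h := (hcont.comp (Continuous.prodMk_left z)).tendsto 0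
    simp only [Function.comp_def, zero_mul, mul_zero] at h
    have h0 : (ι z.1 + fun _ : Fin n × Fin 2 => (0 : ℝ)) = ι z.1 := by ext; simp
    rw [h0] at h
    exact h.comp tendsto_one_div_add_atTop_nhds_zero_nat

end Slice

section CosTransform

variable {f : (Fin 2 → ℝ) → ℝ}

lemma continuous_cosTransform (hfi : Integrable f) : Continuous (cosTransform f) := by
  unfold cosTransform
  refine continuous_of_dominated (bound := fun v => ‖f v‖) (fun ξ => ?_) (fun ξ => ?_) hfi.norm ?_
  · exact hfi.aestronglyMeasurable.mul (by fun_prop)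
  · refine Eventually.of_forall fun v => ?_
    rw [norm_mul]
    exact mul_le_of_le_one_right (norm_nonneg _) (abs_cos_le_one _)
  · exact Eventually.of_forall fun v => by fun_prop

lemma norm_cosTransform_le (hfi : Integrable f) (ξ : Fin 2 → ℝ) :
    ‖cosTransform f ξ‖ ≤ ∫ v, ‖f v‖ := by
  refine norm_integral_le_of_norm_le hfi.norm (Eventually.of_forall fun v => ?_)
  rw [norm_mul]
  exact mul_le_of_le_one_right (norm_nonneg _) (abs_cos_le_one _)

lemma integrable_gauss_mul_prod_cosTransform (hfi : Integrable f) {n : ℕ} (θ : Fin n → ℝ) {τ : ℝ}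
    (hτ : 0 < τ) : Integrable fun ξ : Fin 2 → ℝ =>
      exp (-(τ ^ 2 * (ξ 0 ^ 2 + ξ 1 ^ 2))) * ∏ i, cosTransform f (θ i • ξ) := by
  have hc := continuous_cosTransform hfi
  refine (integrable_exp_neg_normSq (by positivity)).mul_bdd (c := ∏ _i : Fin n, ∫ v, ‖f v‖)
    (Continuous.aestronglyMeasurable (by fun_prop)) (Eventually.of_forall fun ξ => ?_)
  rw [norm_prod]
  exact Finset.prod_le_prod (fun _ _ => norm_nonneg _) fun _ _ => norm_cosTransform_le hfi _

end CosTransform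

section Extremal

variable {n d : ℕ} {N : (Fin 2 → ℝ) → ℝ} {p : ℝ}

lemma IsNormOn.isGaussMix_exp_neg_rpow (hN : IsNormOn 2 N) (hp0 : 0 < p) (hp1 : p ≤ 1) :
    IsGaussMix fun v => exp (-N v ^ p) := by
  simpa using (hN.isGaussExponent.rpow hp0 hp1).2 1 zero_le_one

lemma mollifiedSection_eq_integral_cosTransform (hN : IsNormOn 2 N) (hp : 0 < p)
    (θ : Fin n → ℝ) {τ : ℝ} (hτ : 0 < τ) : mollifiedSection n p N θ τ =
      ∫ ξ : Fin 2 → ℝ, exp (-(τ ^ 2 * (ξ 0 ^ 2 + ξ 1 ^ 2))) *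
        ∏ i, cosTransform (fun v => exp (-N v ^ p)) (θ i • ξ) :=
  integral_prod_mul_gauss_eq (integrable_exp_neg_rpow hN hp) (fun v => by rw [hN.neg]) θ hτ

lemma mollifiedSection_diag_le (hN : IsNormOn 2 N) (hp0 : 0 < p) (hp1 : p ≤ 1)
    {θ : Fin n → ℝ} (hθ : ∑ i, θ i ^ 2 = 1) {τ : ℝ} (hτ : 0 < τ) :
    mollifiedSection n p N (fun _ => (√n)⁻¹) τ ≤ mollifiedSection n p N θ τ := by
  have hfi := integrable_exp_neg_rpow hN hp0
  rw [mollifiedSection_eq_integral_cosTransform hN hp0 _ hτ,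
    mollifiedSection_eq_integral_cosTransform hN hp0 _ hτ]
  exact integral_mono (integrable_gauss_mul_prod_cosTransform hfi _ hτ)
    (integrable_gauss_mul_prod_cosTransform hfi _ hτ) fun ξ => mul_le_mul_of_nonneg_left
      ((hN.isGaussMix_exp_neg_rpow hp0 hp1).cosTransform_pow_le hfi hθ ξ) (exp_pos _).le

lemma mollifiedSection_one_le (hN : IsNormOn 2 N) (hp : 0 < p) {τ : ℝ} (hτ : 0 < τ) :
    mollifiedSection 1 p N (fun _ => 1) τ ≤ 4 * π ^ 2 := by
  set g : (Fin 2 → ℝ) → ℝ := fun v => π / τ ^ 2 * exp (-((4 * τ ^ 2)⁻¹ * (v 0 ^ 2 + v 1 ^ 2)))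
  have hg : Integrable g := (integrable_exp_neg_normSq (by positivity)).const_mul _
  have h1 : ∫ x : Fin 1 × Fin 2 → ℝ, ∏ i, g (fun j => x (i, j)) = 4 * π ^ 2 := by
    rw [integral_prod_blocks fun _ => g, Fin.prod_univ_one, integral_const_mul,
      integral_exp_neg_normSq (by positivity)]
    field_simp
  rw [← h1]
  refine integral_mono (integrable_mollified hN hp _ τ) (integrable_prod_blocks hg) fun x => ?_
  simp only [Fin.prod_univ_one, Fin.sum_univ_one, one_mul, g, div_eq_inv_mul _ (4 * τ ^ 2)]
  exact mul_le_of_le_one_left (by positivity)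
    (exp_le_one_iff.2 (neg_nonpos.2 (rpow_nonneg (hN.nonneg _) _)))

lemma mollifiedSection_le (hN : IsNormOn 2 N) (hp0 : 0 < p) (hp1 : p ≤ 1)
    {θ : Fin n → ℝ} (hθ : ∑ i, θ i ^ 2 = 1) {τ : ℝ} (hτ : 0 < τ) :
    mollifiedSection n p N θ τ ≤ 4 * π ^ 2 * (∫ v, exp (-N v ^ p)) ^ (n - 1) := by
  have hfi := integrable_exp_neg_rpow hN hp0
  have hf := hN.isGaussMix_exp_neg_rpow hp0 hp1
  have h0 : 0 ≤ (∫ v, exp (-N v ^ p)) ^ (n - 1) :=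
    pow_nonneg (integral_nonneg fun _ => (exp_pos _).le) _
  refine le_trans ?_ (mul_le_mul_of_nonneg_right (mollifiedSection_one_le hN hp0 hτ) h0)
  rw [mollifiedSection_eq_integral_cosTransform hN hp0 _ hτ,
    mollifiedSection_eq_integral_cosTransform hN hp0 _ hτ, ← integral_mul_const]
  refine integral_mono (integrable_gauss_mul_prod_cosTransform hfi _ hτ)
    ((integrable_gauss_mul_prod_cosTransform hfi _ hτ).mul_const _) fun ξ => ?_
  simp only [Fin.prod_univ_one, one_smul]
  rw [mul_assoc]
  refine mul_le_mul_of_nonneg_left ?_ (exp_pos _).le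
  refine (hf.prod_cosTransform_le hfi hθ ξ).trans_eq ?_
  rw [cosTransform_zero, mul_comm]

lemma integral_exp_neg_lpSum_diag_le (hN : IsNormOn 2 N) (hp0 : 0 < p) (hp1 : p ≤ 1)
    (hd : d + 2 = n * 2) {θ : Fin n → ℝ} (hθ : ∑ i, θ i ^ 2 = 1)
    {ι κ : (Fin d → ℝ) →ₗ[ℝ] (Fin n × Fin 2 → ℝ)}
    (hι : ∀ y, ∑ c, ι y c ^ 2 = ∑ i, y i ^ 2) (hιθ : ∀ y j, ∑ i, θ i * ι y (i, j) = 0)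
    (hκ : ∀ y, ∑ c, κ y c ^ 2 = ∑ i, y i ^ 2) (hκd : ∀ y j, ∑ i, κ y (i, j) = 0) :
    ∫ y, exp (-lpSum n p N (κ y)) ≤ ∫ y, exp (-lpSum n p N (ι y)) := by
  have hn : 0 < n := by omega
  have hdiag : ∑ _i : Fin n, ((√n)⁻¹) ^ 2 = 1 := by
    rw [Finset.sum_const, Finset.card_univ, Fintype.card_fin, nsmul_eq_mul, inv_pow,
      sq_sqrt n.cast_nonneg, mul_inv_cancel₀ (by positivity)]
  have h := le_of_tendsto_of_tendsto'
    (tendsto_mollifiedSection (θ := fun _ => (√n)⁻¹) hN hp0 hp1 hd hdiag hκ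
      fun y j => by rw [← Finset.mul_sum, hκd, mul_zero])
    (tendsto_mollifiedSection hN hp0 hp1 hd hθ hι hιθ)
    fun k => mollifiedSection_diag_le hN hp0 hp1 hθ (by positivity)
  exact le_of_mul_le_mul_left h (by positivity)

lemma integral_exp_neg_lpSum_le (hN : IsNormOn 2 N) (hp0 : 0 < p) (hp1 : p ≤ 1)
    (hd : d + 2 = n * 2) {θ : Fin n → ℝ} (hθ : ∑ i, θ i ^ 2 = 1)
    {ι : (Fin d → ℝ) →ₗ[ℝ] (Fin n × Fin 2 → ℝ)}
    (hι : ∀ y, ∑ c, ι y c ^ 2 = ∑ i, y i ^ 2) (hιθ : ∀ y j, ∑ i, θ i * ι y (i, j) = 0) :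
    ∫ y, exp (-lpSum n p N (ι y)) ≤ ∫ x, exp (-lpSum (n - 1) p N x) := by
  have h1 : ∫ x, exp (-lpSum (n - 1) p N x) = (∫ v, exp (-N v ^ p)) ^ (n - 1) := by
    simp only [exp_neg_lpSum]
    rw [integral_prod_blocks (n := n - 1) fun _ v => exp (-N v ^ p), Finset.prod_const,
      Finset.card_univ, Fintype.card_fin]
  rw [h1]
  exact le_of_mul_le_mul_left (le_of_tendsto' (tendsto_mollifiedSection hN hp0 hp1 hd hθ hι hιθ)
    fun k => mollifiedSection_le hN hp0 hp1 hθ (by positivity)) (by positivity)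

end Extremal

/-- **Extremal sections for arbitrary two-dimensional normed spaces and `p ∈ (0,1]`.**
Let `X = (ℝ², N)` be any two-dimensional normed space and `p ∈ (0,1]`. Then for every unit
vector `θ` of `ℝ^n`, `|B_p^n(X) ∩ H_diag| ≤ |B_p^n(X) ∩ H_θ| ≤ |B_p^{n-1}(X)|`, where
`H_diag = H_{(1,…,1)}` and the `2(n-1)`-dimensional Lebesgue measures of the sections are
computed via Euclidean isometric parametrizations. -/
theorem sections_extremal_dim_two (n : ℕ) (p : ℝ) (hp0 : 0 < p) (hp1 : p ≤ 1)
    (N : (Fin 2 → ℝ) → ℝ) (hN : IsNormOn 2 N)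
    (θ : Fin n → ℝ) (hθ : ∑ i, θ i ^ 2 = 1)
    (ιθ ιd : (Fin (2 * (n - 1)) → ℝ) →ₗ[ℝ] (Fin n × Fin 2 → ℝ))
    (hιθ : IsEuclParam 2 n (2 * (n - 1)) ιθ (blockHyp 2 n θ))
    (hιd : IsEuclParam 2 n (2 * (n - 1)) ιd (blockHyp 2 n (fun _ => 1))) :
    volume (⇑ιd ⁻¹' (lpBall 2 n p N ∩ blockHyp 2 n (fun _ => 1))) ≤
        volume (⇑ιθ ⁻¹' (lpBall 2 n p N ∩ blockHyp 2 n θ)) ∧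
      volume (⇑ιθ ⁻¹' (lpBall 2 n p N ∩ blockHyp 2 n θ)) ≤ volume (lpBall 2 (n - 1) p N) := by
  have hn : n ≠ 0 := by
    rintro rfl
    simp at hθ
  have hd : 2 * (n - 1) + 2 = n * 2 := by omega
  have hpre : ∀ (η : Fin n → ℝ) (ι : (Fin (2 * (n - 1)) → ℝ) →ₗ[ℝ] (Fin n × Fin 2 → ℝ)),
      IsEuclParam 2 n (2 * (n - 1)) ι (blockHyp 2 n η) →
      ⇑ι ⁻¹' (lpBall 2 n p N ∩ blockHyp 2 n η) = {y | lpSum n p N (ι y) ≤ 1} := by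
    intro η ι hι
    rw [← hι.2, Set.preimage_inter, Set.preimage_range, Set.inter_univ]
    rfl
  have horth : ∀ (η : Fin n → ℝ) (ι : (Fin (2 * (n - 1)) → ℝ) →ₗ[ℝ] (Fin n × Fin 2 → ℝ)),
      IsEuclParam 2 n (2 * (n - 1)) ι (blockHyp 2 n η) →
      ∀ y j, ∑ i, η i * ι y (i, j) = 0 := by
    intro η ι hι y
    have h : ι y ∈ blockHyp 2 n η := hι.2 ▸ Set.mem_range_self y
    exact h
  have hmeas : ∀ ι : (Fin (2 * (n - 1)) → ℝ) →ₗ[ℝ] (Fin n × Fin 2 → ℝ),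
      Measurable fun y => lpSum n p N (ι y) := fun ι =>
    ((continuous_lpSum hN hp0).comp ι.continuous_of_finiteDimensional).measurable
  have hhom : ∀ (ι : (Fin (2 * (n - 1)) → ℝ) →ₗ[ℝ] (Fin n × Fin 2 → ℝ)) (c : ℝ), 0 < c →
      ∀ y, lpSum n p N (ι (c • y)) = c ^ p * lpSum n p N (ι y) := fun ι c hc y => by
    rw [map_smul, lpSum_smul hN hc]
  have hInt := fun (ι : (Fin (2 * (n - 1)) → ℝ) →ₗ[ℝ] (Fin n × Fin 2 → ℝ)) hι =>
    integrable_exp_neg_lpSum_comp hN hp0 ι hι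
  rw [hpre _ _ hιθ, hpre _ _ hιd]
  refine ⟨volume_le_of_integral_exp_neg_le hp0 rfl (hmeas ιd) (fun _ => lpSum_nonneg hN _)
    (hhom ιd) (hInt ιd hιd.1) (hmeas ιθ) (fun _ => lpSum_nonneg hN _) (hhom ιθ) (hInt ιθ hιθ.1)
    (integral_exp_neg_lpSum_diag_le hN hp0 hp1 hd hθ hιθ.1 (horth _ _ hιθ) hιd.1 fun y j => ?_), ?_⟩
  · simpa using horth _ _ hιd y j
  · exact volume_le_of_integral_exp_neg_le (Φ := lpSum (n - 1) p N) hp0 (by simp [mul_comm])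
      (hmeas ιθ) (fun _ => lpSum_nonneg hN _) (hhom ιθ) (hInt ιθ hιθ.1)
      (continuous_lpSum hN hp0).measurable (lpSum_nonneg hN) (fun c hc y => lpSum_smul hN hc y)
      (integrable_exp_neg_lpSum_comp hN hp0 LinearMap.id fun _ => rfl)
      (integral_exp_neg_lpSum_le hN hp0 hp1 hd hθ hιθ.1 (horth _ _ hιθ))
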